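/- arXiv:2404.17165 — 2 statements merged into one kernel-verified Lean document; each statement's English description precedes it below -/
import Mathlib

section
/- For every integer n > 30, ψ(n) < e^γ · n · log(log(n)), where ψ is the Dedekind psi function. -/
/-- The Dedekind psi function `ψ(n) = n ∏_{p ∣ n} (1 + 1/p)`. -/
noncomputable def dedekindPsi (n : ℕ) : ℝ :=
  n * ∏ p ∈ n.primeFactors, (1 + 1 / (p : ℝ))

open Real Finset

namespace DedekindPsi

/-! ### Explicit numerical bounds -/

/-- Trial division by the integers `2, …, 28`. -/
def TrialPrime (p : ℕ) : Prop := 2 ≤ p ∧ ∀ d ∈ List.range 29, d < 2 ∨ p % d ≠ 0 ∨ p = d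

instance : DecidablePred TrialPrime := fun _ => inferInstanceAs (Decidable (_ ∧ _))

lemma prime_iff_trialPrime {p : ℕ} (hp : p < 841) : p.Prime ↔ TrialPrime p := by
  constructor
  · intro h
    refine ⟨h.two_le, fun d _ => ?_⟩
    by_cases hd : d < 2
    · exact Or.inl hd
    by_cases hpd : p % d = 0
    · rcases (Nat.dvd_prime h).1 (Nat.dvd_of_mod_eq_zero hpd) with h1 | h1
      · omega
      · exact Or.inr (Or.inr h1.symm)
    · exact Or.inr (Or.inl hpd)
  · rintro ⟨h2, h⟩
    by_contra hnp
    have hsq := Nat.minFac_sq_le_self (by omega) hnp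
    have hlt : p.minFac < 29 := by nlinarith
    have hprime := Nat.minFac_prime (n := p) (by omega)
    rcases h p.minFac (List.mem_range.2 hlt) with h1 | h1 | h1
    · exact absurd hprime.two_le (by omega)
    · exact h1 (Nat.mod_eq_zero_of_dvd (Nat.minFac_dvd p))
    · exact hnp (h1 ▸ hprime)

lemma primesLE_eq_filter_trialPrime {b : ℕ} (hb : b < 841) :
    b.primesLE = (range (b + 1)).filter TrialPrime := by
  ext p
  rw [Nat.mem_primesLE, mem_filter, mem_range, Nat.lt_succ_iff]
  exact and_congr_right fun h => prime_iff_trialPrime (by omega)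

lemma primeFactors_eq_filter_trialPrime {n : ℕ} (hn : n < 841) (h0 : n ≠ 0) :
    n.primeFactors = (range (n + 1)).filter (fun p => p ∣ n ∧ TrialPrime p) := by
  ext p
  rw [Nat.mem_primeFactors, mem_filter, mem_range, Nat.lt_succ_iff]
  constructor
  · rintro ⟨hp, hd, -⟩
    have := Nat.le_of_dvd (by omega) hd
    exact ⟨this, hd, (prime_iff_trialPrime (by omega)).1 hp⟩
  · rintro ⟨h, hd, hp⟩
    exact ⟨(prime_iff_trialPrime (by omega)).2 hp, hd, h0⟩

lemma prod_one_add_inv_le {S : Finset ℕ} (hS : ∀ p ∈ S, 0 < p) {u v : ℕ} (hv : 0 < v)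
    (h : v * ∏ p ∈ S, (p + 1) ≤ u * ∏ p ∈ S, p) :
    ∏ p ∈ S, (1 + 1 / (p : ℝ)) ≤ u / v := by
  have hpos : (0 : ℝ) < ∏ p ∈ S, (p : ℝ) :=
    prod_pos fun p hp => by exact_mod_cast hS p hp
  have heq : ∏ p ∈ S, (1 + 1 / (p : ℝ)) = (∏ p ∈ S, ((p : ℝ) + 1)) / ∏ p ∈ S, (p : ℝ) := by
    rw [← prod_div_distrib]
    refine prod_congr rfl fun p hp => ?_
    have : (p : ℝ) ≠ 0 := by exact_mod_cast (hS p hp).ne'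
    field_simp
  rw [heq, div_le_div_iff₀ hpos (by exact_mod_cast hv)]
  have : (v : ℝ) * ∏ p ∈ S, ((p : ℝ) + 1) ≤ u * ∏ p ∈ S, (p : ℝ) := by
    have := (Nat.cast_le (α := ℝ)).2 h
    push_cast at this
    exact this
  linarith

lemma prod_primesLE_le {b u v : ℕ} (hb : b < 841) (hv : 0 < v)
    (h : v * ∏ p ∈ (range (b + 1)).filter TrialPrime, (p + 1) ≤
      u * ∏ p ∈ (range (b + 1)).filter TrialPrime, p) :
    ∏ p ∈ b.primesLE, (1 + 1 / (p : ℝ)) ≤ u / v := by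
  rw [primesLE_eq_filter_trialPrime hb]
  exact prod_one_add_inv_le (fun p hp => by have := (mem_filter.1 hp).2.1; omega) hv h

lemma div_le_log_of_pow_le {t : ℝ} {a b : ℕ} (ht : 0 < t) (hb : 0 < b)
    (h : (2.7182818286 : ℝ) ^ a ≤ t ^ b) : (a : ℝ) / b ≤ log t := by
  have hb' : (0 : ℝ) < b := by exact_mod_cast hb
  rw [div_le_iff₀ hb', mul_comm, ← log_pow, le_log_iff_exp_le (by positivity)]
  calc exp a = exp 1 ^ a := by rw [← exp_nat_mul, mul_one]
    _ ≤ 2.7182818286 ^ a := pow_le_pow_left₀ (exp_pos _).le exp_one_lt_d9.le a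
    _ ≤ t ^ b := h

lemma log_le_div_of_pow_le {t : ℝ} {a b : ℕ} (ht : 0 < t) (hb : 0 < b)
    (h : t ^ b ≤ (2.7182818283 : ℝ) ^ a) : log t ≤ (a : ℝ) / b := by
  have hb' : (0 : ℝ) < b := by exact_mod_cast hb
  rw [le_div_iff₀ hb', mul_comm, ← log_pow, log_le_iff_le_exp (by positivity)]
  calc t ^ b ≤ 2.7182818283 ^ a := h
    _ ≤ exp 1 ^ a := pow_le_pow_left₀ (by norm_num) exp_one_gt_d9.le a
    _ = exp a := by rw [← exp_nat_mul, mul_one]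

lemma mul_log_two_le_log {m n j k : ℕ} (hj : 0 < j) (hm : 0 < m) (hmn : m ≤ n)
    (h : 2 ^ k ≤ m ^ j) : (k : ℝ) / j * log 2 ≤ log n := by
  have hj' : (0 : ℝ) < j := by exact_mod_cast hj
  have hm' : (0 : ℝ) < m := by exact_mod_cast hm
  have h1 : (k : ℝ) * log 2 ≤ j * log m := by
    rw [← log_pow, ← log_pow]
    exact log_le_log (by positivity) (by exact_mod_cast h)
  have h2 : log m ≤ log n := log_le_log hm' (by exact_mod_cast hmn)
  rw [div_mul_eq_mul_div, div_le_iff₀ hj']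
  nlinarith

lemma eulerMascheroniConstant_gt : 0.56 < eulerMascheroniConstant := by
  refine lt_trans ?_ (eulerMascheroniSeq_lt_eulerMascheroniConstant 31)
  have h1 : log ((31 : ℕ) + 1) = 5 * log 2 := by
    rw [show ((31 : ℕ) : ℝ) + 1 = 2 ^ 5 by norm_num, log_pow]; norm_num
  have h2 : (4.027 : ℚ) ≤ harmonic 31 := by
    simp only [harmonic, sum_range_succ, sum_range_zero]; norm_num
  have h3 : (4.027 : ℝ) ≤ harmonic 31 := by
    have : ((4.027 : ℚ) : ℝ) ≤ harmonic 31 := by exact_mod_cast h2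
    norm_num at this ⊢
  rw [eulerMascheroniSeq, h1]
  linarith [log_two_lt_d9]

lemma exp_eulerMascheroniConstant_gt : 7 / 4 < exp eulerMascheroniConstant := by
  rw [← log_lt_iff_lt_exp (by norm_num)]
  have := log_le_div_of_pow_le (t := 7 / 4) (a := 14) (b := 25) (by norm_num) (by norm_num)
    (by norm_num)
  have h2 := eulerMascheroniConstant_gt
  norm_num at this h2
  linarith

lemma dedekindPsi_lt_of_prod_lt {n : ℕ} (hn : 0 < n)
    (h : ∏ p ∈ n.primeFactors, (1 + 1 / (p : ℝ)) <
      exp eulerMascheroniConstant * log (log n)) :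
    dedekindPsi n < exp eulerMascheroniConstant * n * log (log n) := by
  have : (0 : ℝ) < n := by exact_mod_cast hn
  rw [dedekindPsi]
  nlinarith

lemma dedekindPsi_lt_of_prod_le {n m j k a b u v : ℕ} (hu : 0 < u) (hv : 0 < v) (hm : 0 < m)
    (hj : 0 < j) (hk : 0 < k) (hb : 0 < b)
    (hprod : ∏ p ∈ n.primeFactors, (1 + 1 / (p : ℝ)) ≤ u / v) (hmn : m ≤ n)
    (hpow : 2 ^ k ≤ m ^ j)
    (hexp : (2.7182818286 : ℝ) ^ a ≤ ((k : ℝ) / j * 0.6931471803) ^ b)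
    (hlt : u * (4 * b) < 7 * a * v) :
    dedekindPsi n < exp eulerMascheroniConstant * n * log (log n) := by
  refine dedekindPsi_lt_of_prod_lt (hm.trans_le hmn) (hprod.trans_lt ?_)
  have hv' : (0 : ℝ) < v := by exact_mod_cast hv
  have hb' : (0 : ℝ) < b := by exact_mod_cast hb
  have hk' : (0 : ℝ) < k := by exact_mod_cast hk
  have hj' : (0 : ℝ) < j := by exact_mod_cast hj
  have hu' : (0 : ℝ) < u := by exact_mod_cast hu
  have hlog : (k : ℝ) / j * 0.6931471803 ≤ log n :=
    (mul_le_mul_of_nonneg_left log_two_gt_d9.le (by positivity)).trans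
      (mul_log_two_le_log hj hm hmn hpow)
  have hll : (a : ℝ) / b ≤ log (log n) :=
    (div_le_log_of_pow_le (by positivity) hb hexp).trans (log_le_log (by positivity) hlog)
  have h1 : (u : ℝ) / v < 7 / 4 * (a / b) := by
    have : (u : ℝ) * (4 * b) < 7 * a * v := by exact_mod_cast hlt
    rw [← mul_div_mul_comm, div_lt_div_iff₀ hv' (by positivity)]
    linarith
  have h2 : (0 : ℝ) < u / v := by positivity
  nlinarith [exp_eulerMascheroniConstant_gt]

/-! ### Comparing the prime factors of `n` with the primes up to `x` -/

lemma sum_log_primeFactors_le (n : ℕ) (hn : 0 < n) : ∑ p ∈ n.primeFactors, log p ≤ log n := by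
  rw [← log_prod (fun p hp => by exact_mod_cast (Nat.prime_of_mem_primeFactors hp).ne_zero)]
  have h := Nat.le_of_dvd hn (Nat.prod_primeFactors_dvd n)
  have hpos : 0 < ∏ p ∈ n.primeFactors, p :=
    prod_pos fun p hp => (Nat.prime_of_mem_primeFactors hp).pos
  have e : ∏ p ∈ n.primeFactors, (p : ℝ) = ((∏ p ∈ n.primeFactors, p : ℕ) : ℝ) := by push_cast; rfl
  rw [e]
  exact log_le_log (by exact_mod_cast hpos) (by exact_mod_cast h)

lemma inv_succ_le_log_one_add_inv {p : ℝ} (hp : 0 < p) : 1 / (p + 1) ≤ log (1 + 1 / p) := by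
  have h := one_sub_inv_le_log_of_pos (x := 1 + 1 / p) (by positivity)
  have e : 1 - (1 + 1 / p)⁻¹ = 1 / (p + 1) := by field_simp; ring
  linarith

lemma log_one_add_inv_le {p : ℝ} (hp : 0 < p) : log (1 + 1 / p) ≤ 1 / p := by
  have h := log_le_sub_one_of_pos (x := 1 + 1 / p) (by positivity)
  linarith

lemma sum_log_one_add_inv_le {n x : ℕ} (hn : 0 < n) (hx : 2 ≤ x) :
    ∑ p ∈ n.primeFactors, log (1 + 1 / (p : ℝ)) ≤
      ∑ p ∈ x.primesLE, log (1 + 1 / (p : ℝ)) +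
        1 / ((x + 1) * log x) * (log n - ∑ p ∈ x.primesLE, log p) := by
  have hx' : (2 : ℝ) ≤ x := by exact_mod_cast hx
  have hlx : 0 < log x := log_pos (by linarith)
  set l : ℝ := 1 / ((x + 1) * log x) with hl
  have hl0 : 0 < l := by positivity
  have key : ∑ p ∈ n.primeFactors, (log (1 + 1 / (p : ℝ)) - l * log p) ≤
      ∑ p ∈ x.primesLE, (log (1 + 1 / (p : ℝ)) - l * log p) := by
    rw [← sum_filter_add_sum_filter_not n.primeFactors (· ≤ x)]
    have h1 : ∑ p ∈ n.primeFactors with ¬ p ≤ x, (log (1 + 1 / (p : ℝ)) - l * log p) ≤ 0 := by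
      refine sum_nonpos fun p hp => ?_
      rw [mem_filter, not_le] at hp
      have hp1 : (x : ℝ) + 1 ≤ p := by exact_mod_cast hp.2
      have h2 : log x ≤ log p := log_le_log (by linarith) (by linarith)
      have h3 : log (1 + 1 / (p : ℝ)) ≤ 1 / p := log_one_add_inv_le (by linarith)
      have h4 : 1 / (p : ℝ) ≤ 1 / (x + 1) := one_div_le_one_div_of_le (by linarith) hp1
      have h5 : 1 / ((x : ℝ) + 1) = l * log x := by rw [hl]; field_simp
      have h6 : l * log x ≤ l * log p := mul_le_mul_of_nonneg_left h2 hl0.le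
      linarith
    have h2 : ∑ p ∈ n.primeFactors with p ≤ x, (log (1 + 1 / (p : ℝ)) - l * log p) ≤
        ∑ p ∈ x.primesLE, (log (1 + 1 / (p : ℝ)) - l * log p) := by
      refine sum_le_sum_of_subset_of_nonneg ?_ fun p hp _ => ?_
      · intro p hp
        rw [mem_filter] at hp
        exact Nat.mem_primesLE.2 ⟨hp.2, Nat.prime_of_mem_primeFactors hp.1⟩
      · obtain ⟨hpx, hpp⟩ := Nat.mem_primesLE.1 hp
        have hp0 : (1 : ℝ) ≤ p := by exact_mod_cast hpp.one_lt.le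
        have hpx' : (p : ℝ) ≤ x := by exact_mod_cast hpx
        have h2 : log p ≤ log x := log_le_log (by linarith) hpx'
        have h3 : 1 / ((p : ℝ) + 1) ≤ log (1 + 1 / (p : ℝ)) :=
          inv_succ_le_log_one_add_inv (by linarith)
        have h4 : 1 / ((x : ℝ) + 1) ≤ 1 / (p + 1) :=
          one_div_le_one_div_of_le (by linarith) (by linarith)
        have h5 : 1 / ((x : ℝ) + 1) = l * log x := by rw [hl]; field_simp
        have h6 : l * log p ≤ l * log x := mul_le_mul_of_nonneg_left h2 hl0.le
        linarith
    linarith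
  rw [sum_sub_distrib, sum_sub_distrib, ← mul_sum, ← mul_sum] at key
  have h := mul_le_mul_of_nonneg_left (sum_log_primeFactors_le n hn) hl0.le
  rw [mul_sub]
  linarith

lemma log_prod_one_add_inv {S : Finset ℕ} :
    log (∏ p ∈ S, (1 + 1 / (p : ℝ))) = ∑ p ∈ S, log (1 + 1 / (p : ℝ)) :=
  log_prod fun p _ => by positivity

lemma prod_primeFactors_le_of_le_prod {n x : ℕ} (hn : 0 < n) (hx : 2 ≤ x)
    (h : n ≤ ∏ p ∈ x.primesLE, p) :
    ∏ p ∈ n.primeFactors, (1 + 1 / (p : ℝ)) ≤ ∏ p ∈ x.primesLE, (1 + 1 / (p : ℝ)) := by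
  rw [← log_le_log_iff (prod_pos fun p _ => by positivity) (prod_pos fun p _ => by positivity),
    log_prod_one_add_inv, log_prod_one_add_inv]
  refine (sum_log_one_add_inv_le hn hx).trans ?_
  have h1 : log n ≤ ∑ p ∈ x.primesLE, log p := by
    rw [← log_prod (fun p hp => by exact_mod_cast (Nat.mem_primesLE.1 hp).2.ne_zero)]
    rw [← Nat.cast_prod]
    exact log_le_log (by exact_mod_cast hn) (Nat.cast_le.2 h)
  have hlx : 0 ≤ log x := log_natCast_nonneg x
  have := mul_nonneg (show (0 : ℝ) ≤ 1 / ((x + 1) * log x) by positivity) (sub_nonneg.2 h1)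
  linarith

/-- The bound for `m ≤ n ≤ ∏ p ≤ x, p`, given numerical certificates. -/
lemma dedekindPsi_lt_of_le_primorial {n x m j k a b u v : ℕ} (hx : 2 ≤ x) (hx' : x < 841)
    (hu : 0 < u) (hv : 0 < v) (hm : 0 < m) (hj : 0 < j) (hk : 0 < k) (hb : 0 < b)
    (hprod : v * ∏ p ∈ (range (x + 1)).filter TrialPrime, (p + 1) ≤
      u * ∏ p ∈ (range (x + 1)).filter TrialPrime, p)
    (hmn : m ≤ n) (hnx : n ≤ ∏ p ∈ (range (x + 1)).filter TrialPrime, p)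
    (hpow : 2 ^ k ≤ m ^ j)
    (hexp : (2.7182818286 : ℝ) ^ a ≤ ((k : ℝ) / j * 0.6931471803) ^ b)
    (hlt : u * (4 * b) < 7 * a * v) :
    dedekindPsi n < exp eulerMascheroniConstant * n * log (log n) := by
  rw [← primesLE_eq_filter_trialPrime hx'] at hnx
  exact dedekindPsi_lt_of_prod_le hu hv hm hj hk hb
    ((prod_primeFactors_le_of_le_prod (hm.trans_le hmn) hx hnx).trans
      (prod_primesLE_le hx' hv hprod)) hmn hpow hexp hlt

/-- The bound for `m ≤ n < 841`, given numerical certificates. -/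
lemma dedekindPsi_lt_of_lt {n m j k a b u v : ℕ} (hn : n < 841)
    (hu : 0 < u) (hv : 0 < v) (hm : 0 < m) (hj : 0 < j) (hk : 0 < k) (hb : 0 < b)
    (hprod : v * ∏ p ∈ (range (n + 1)).filter (fun p => p ∣ n ∧ TrialPrime p), (p + 1) ≤
      u * ∏ p ∈ (range (n + 1)).filter (fun p => p ∣ n ∧ TrialPrime p), p)
    (hmn : m ≤ n) (hpow : 2 ^ k ≤ m ^ j)
    (hexp : (2.7182818286 : ℝ) ^ a ≤ ((k : ℝ) / j * 0.6931471803) ^ b)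
    (hlt : u * (4 * b) < 7 * a * v) :
    dedekindPsi n < exp eulerMascheroniConstant * n * log (log n) := by
  rw [← primeFactors_eq_filter_trialPrime hn (by omega)] at hprod
  exact dedekindPsi_lt_of_prod_le hu hv hm hj hk hb
    (prod_one_add_inv_le (fun p hp => (Nat.prime_of_mem_primeFactors hp).pos) hv hprod)
    hmn hpow hexp hlt

/-! ### A Mertens-type upper bound for `∑ 1 / p` -/

lemma log_factorial_le (n : ℕ) (hn : 1 ≤ n) :
    log (n.factorial : ℝ) ≤ n * log n - n + log n + 1 := by
  induction n, hn using Nat.le_induction with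
  | base => simp
  | succ n hn ih =>
    have hn' : (0 : ℝ) < n := by exact_mod_cast hn
    have h := inv_succ_le_log_one_add_inv hn'
    rw [show 1 + 1 / (n : ℝ) = (n + 1) / n by field_simp,
      log_div (by positivity) (by positivity), div_le_iff₀ (by positivity)] at h
    rw [Nat.factorial_succ]
    push_cast
    rw [log_mul (by positivity) (by positivity)]
    linarith

lemma sum_log_mul_div_le_log_factorial (n : ℕ) :
    ∑ p ∈ n.primesLE, log p * ((n / p : ℕ) : ℝ) ≤ log (n.factorial : ℝ) := by
  have h1 : log (n.factorial : ℝ) = ∑ m ∈ Ioc 0 n, log m := by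
    rw [← log_prod (fun m hm => by
      have := (mem_Ioc.1 hm).1; exact_mod_cast this.ne'), ← prod_Ico_id_eq_factorial]
    push_cast
    rfl
  have h2 : ∀ m ∈ Ioc 0 n, ∑ p ∈ n.primesLE, (if p ∣ m then log p else 0) ≤ log (m : ℝ) := by
    intro m hm
    obtain ⟨hm0, hmn⟩ := mem_Ioc.1 hm
    rw [← sum_filter]
    refine le_trans (sum_le_sum_of_subset_of_nonneg ?_ fun p _ _ => log_natCast_nonneg p)
      (sum_log_primeFactors_le m hm0)
    intro p hp
    rw [mem_filter, Nat.mem_primesLE] at hp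
    exact Nat.mem_primeFactors.2 ⟨hp.1.2, hp.2, hm0.ne'⟩
  rw [h1]
  refine le_trans (le_of_eq ?_) (sum_le_sum h2)
  rw [sum_comm]
  refine sum_congr rfl fun p _ => ?_
  rw [← sum_filter, sum_const, Nat.Ioc_filter_dvd_card_eq_div, nsmul_eq_mul, mul_comm]

lemma sum_log_primesLE_le (n : ℕ) : ∑ p ∈ n.primesLE, log p ≤ 2 * log 2 * n := by
  have h := Chebyshev.theta_le_log4_mul_x (x := n) (by positivity)
  rw [Chebyshev.theta_eq_sum_primesLE_log] at h
  rwa [show (4 : ℝ) = 2 ^ 2 by norm_num, log_pow, Nat.cast_ofNat] at h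

lemma log_512 : log (512 : ℝ) = 9 * log 2 := by
  rw [show (512 : ℝ) = 2 ^ 9 by norm_num, log_pow]; norm_num

lemma sum_log_div_le {n : ℕ} (hn : 512 ≤ n) :
    ∑ p ∈ n.primesLE, log p / p ≤ log n + 0.401 := by
  have hn' : (512 : ℝ) ≤ n := by exact_mod_cast hn
  have hn0 : (0 : ℝ) < n := by linarith
  have h1 : n * ∑ p ∈ n.primesLE, log p / p ≤
      ∑ p ∈ n.primesLE, log p * ((n / p : ℕ) : ℝ) + ∑ p ∈ n.primesLE, log p := by
    rw [mul_sum, ← sum_add_distrib]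
    refine sum_le_sum fun p hp => ?_
    have hp0 : (0 : ℝ) < p := by exact_mod_cast (Nat.mem_primesLE.1 hp).2.pos
    have h2 : (n : ℝ) / p ≤ ((n / p : ℕ) : ℝ) + 1 := by
      rw [← Nat.floor_div_eq_div (K := ℝ)]
      exact (Nat.lt_floor_add_one _).le
    have h3 := mul_le_mul_of_nonneg_left h2 (log_natCast_nonneg p)
    calc (n : ℝ) * (log p / p) = log p * (n / p) := by ring
      _ ≤ _ := by linarith
  have h4 := sum_log_mul_div_le_log_factorial n
  have h5 := log_factorial_le n (by omega)
  have h6 := sum_log_primesLE_le n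
  have h7 : log n ≤ n / 512 - 1 + log 512 := by
    have := log_le_sub_one_of_pos (x := (n : ℝ) / 512) (by positivity)
    rw [log_div hn0.ne' (by norm_num)] at this
    linarith
  rw [log_512] at h7
  have h8 := log_two_lt_d9
  have h9 : n * ∑ p ∈ n.primesLE, log p / p ≤ n * (log n + 0.401) := by
    nlinarith
  exact le_of_mul_le_mul_left h9 hn0

lemma sum_primesLE_succ (n : ℕ) (f : ℕ → ℝ) :
    ∑ p ∈ (n + 1).primesLE, f p =
      ∑ p ∈ n.primesLE, f p + if (n + 1).Prime then f (n + 1) else 0 := by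
  have h : ∀ m : ℕ, m.primesLE = (range (m + 1)).filter Nat.Prime := fun m => by
    ext p; rw [Nat.mem_primesLE, mem_filter, mem_range, Nat.lt_succ_iff]
  rw [h, h, sum_filter, sum_filter, sum_range_succ]

/-- Partial summation: a bound `∑ p ≤ k, log p / p ≤ log k + c` for `k ≥ y` controls the growth of
`∑ p ≤ x, 1 / p` beyond `y`. -/
lemma sum_inv_primesLE_le {y : ℕ} (hy : 2 ≤ y) {c : ℝ}
    (hc : ∀ k : ℕ, y ≤ k → ∑ p ∈ k.primesLE, log p / p ≤ log k + c) {x : ℕ} (hx : y ≤ x) :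
    ∑ p ∈ x.primesLE, log (1 + 1 / (p : ℝ)) - ∑ p ∈ y.primesLE, log (1 + 1 / (p : ℝ)) +
        (c + log x - ∑ p ∈ x.primesLE, log p / p) / log x ≤
      log (log x) - log (log y) + (c + log y - ∑ p ∈ y.primesLE, log p / p) / log y := by
  induction x, hx using Nat.le_induction with
  | base => simp
  | succ x hx ih =>
    refine le_trans ?_ (add_le_add_left (a := log (log (x + 1 : ℕ)) - log (log x)) ih |>.trans
      (by linarith))
    have hx2 : (2 : ℝ) ≤ x := by exact_mod_cast hy.trans hx
    have hA := hc x hx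
    rw [sum_primesLE_succ x fun p => log (1 + 1 / (p : ℝ)),
      sum_primesLE_succ x fun p => log p / p]
    set A := ∑ p ∈ x.primesLE, log p / (p : ℝ)
    set T := ∑ p ∈ x.primesLE, log (1 + 1 / (p : ℝ))
    set u := log (x : ℝ)
    set v := log ((x + 1 : ℕ) : ℝ)
    have hu : 0 < u := log_pos (by linarith)
    have huv : u ≤ v := log_le_log (by linarith) (by push_cast; linarith)
    have hv : 0 < v := hu.trans_le huv
    have hll : 1 - u / v ≤ log v - log u := by
      rw [← log_div hv.ne' hu.ne', ← inv_div]
      exact one_sub_inv_le_log_of_pos (by positivity)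
    have hinv : (c - A) * (1 / v - 1 / u) ≤ 1 - u / v := by
      have h1 : 1 / v ≤ 1 / u := one_div_le_one_div_of_le hu huv
      have h2 : 1 - u / v = -u * (1 / v - 1 / u) := by field_simp; ring
      rw [h2]
      nlinarith
    have e1 : (c + u - A) / u = (c - A) * (1 / u) + 1 := by field_simp; ring
    by_cases hp : (x + 1).Prime
    · rw [if_pos hp, if_pos hp]
      set q : ℝ := ((x + 1 : ℕ) : ℝ)
      have hq : 0 < q := by positivity
      have h3 : log (1 + 1 / q) ≤ 1 / q := log_one_add_inv_le hq
      have e2 : (c + v - (A + v / q)) / v = (c - A) * (1 / v) + 1 - 1 / q := by field_simp; ring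
      rw [e1, e2]
      linarith
    · rw [if_neg hp, if_neg hp, add_zero, add_zero]
      have e2 : (c + v - A) / v = (c - A) * (1 / v) + 1 := by field_simp; ring
      rw [e1, e2]
      linarith

lemma sum_log_div_512_ge : 4.937 ≤ ∑ p ∈ Nat.primesLE 512, log (p : ℝ) / p := by
  have hnum : (113963333 : ℕ) ≤
      ∑ p ∈ (range (512 + 1)).filter TrialPrime, Nat.log2 (p ^ 16) * 10 ^ 6 / p := by
    decide +kernel
  rw [← primesLE_eq_filter_trialPrime (by norm_num)] at hnum
  have h : ∀ p ∈ Nat.primesLE 512,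
      ((Nat.log2 (p ^ 16) * 10 ^ 6 / p : ℕ) : ℝ) * (log 2 / (16 * 10 ^ 6)) ≤ log p / p := by
    intro p hp
    have hpp := (Nat.mem_primesLE.1 hp).2.pos
    have hp0 : (0 : ℝ) < p := by exact_mod_cast hpp
    have h1 : ((Nat.log2 (p ^ 16) * 10 ^ 6 / p : ℕ) : ℝ) ≤ Nat.log2 (p ^ 16) * 10 ^ 6 / p := by
      refine (Nat.cast_div_le (α := ℝ) (m := Nat.log2 (p ^ 16) * 10 ^ 6) (n := p)).trans_eq ?_
      push_cast
      norm_num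
    have h2 := mul_log_two_le_log (m := p) (n := p) (j := 16) (by norm_num) hpp le_rfl
      (Nat.log2_self_le (pow_pos hpp 16).ne')
    have hl : 0 < log 2 := log_pos (by norm_num)
    calc _ ≤ (Nat.log2 (p ^ 16) * 10 ^ 6 / p : ℝ) * (log 2 / (16 * 10 ^ 6)) :=
          mul_le_mul_of_nonneg_right h1 (by positivity)
      _ = (Nat.log2 (p ^ 16) / (16 : ℕ) * log 2) / p := by push_cast; field_simp
      _ ≤ _ := div_le_div_of_nonneg_right h2 hp0.le
  refine le_trans ?_ (sum_le_sum h)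
  rw [← sum_mul, ← Nat.cast_sum]
  have h3 : ((113963333 : ℕ) : ℝ) ≤
      ((∑ p ∈ Nat.primesLE 512, Nat.log2 (p ^ 16) * 10 ^ 6 / p : ℕ) : ℝ) := by exact_mod_cast hnum
  have hl := log_two_gt_d9
  refine le_trans ?_ (mul_le_mul_of_nonneg_right h3 (by positivity))
  norm_num at hl ⊢
  linarith

lemma sum_log_one_add_inv_primesLE_512_le :
    ∑ p ∈ Nat.primesLE 512, log (1 + 1 / (p : ℝ)) ≤ 1.92 := by
  rw [← log_prod_one_add_inv]
  have h : ∏ p ∈ Nat.primesLE 512, (1 + 1 / (p : ℝ)) ≤ (6813 : ℕ) / (1000 : ℕ) :=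
    prod_primesLE_le (by norm_num) (by norm_num) (by decide +kernel)
  refine (log_le_log (prod_pos fun p _ => by positivity) h).trans ?_
  refine (log_le_div_of_pow_le (a := 48) (b := 25) (by norm_num) (by norm_num)
    (by norm_num)).trans ?_
  norm_num

lemma sum_log_one_add_inv_primesLE_le {x : ℕ} (hx : 512 ≤ x) :
    ∑ p ∈ x.primesLE, log (1 + 1 / (p : ℝ)) ≤ log (log x) + 0.37 := by
  have hx' : (512 : ℝ) ≤ x := by exact_mod_cast hx
  have hP := sum_inv_primesLE_le (y := 512) (by norm_num) (fun k hk => sum_log_div_le hk) hx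
  have hD : 0 ≤ (0.401 + log x - ∑ p ∈ x.primesLE, log p / p) / log x :=
    div_nonneg (by linarith [sum_log_div_le hx]) (log_natCast_nonneg x)
  have h1 := sum_log_one_add_inv_primesLE_512_le
  have h2 := sum_log_div_512_ge
  have h3 : ((183 : ℕ) : ℝ) / (100 : ℕ) ≤ log (log (512 : ℕ)) := by
    push_cast
    rw [log_512]
    refine (div_le_log_of_pow_le (t := 9 * 0.6931471803) (by norm_num) (by norm_num)
      (by norm_num)).trans (log_le_log (by norm_num) ?_)
    linarith [log_two_gt_d9]
  have h4 : (0.401 + log (512 : ℕ) - ∑ p ∈ Nat.primesLE 512, log (p : ℝ) / p) / log (512 : ℕ) ≤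
      0.275 := by
    push_cast
    rw [log_512, div_le_iff₀ (by linarith [log_two_gt_d9])]
    linarith [log_two_gt_d9, log_two_lt_d9]
  norm_num at h3
  linarith

/-- The bound for large `n`. -/
lemma dedekindPsi_lt_of_512_le_log {n : ℕ} (hn : 512 ≤ log n) :
    dedekindPsi n < exp eulerMascheroniConstant * n * log (log n) := by
  have hn0 : 0 < n := by
    rcases Nat.eq_zero_or_pos n with rfl | h
    · norm_num at hn
    · exact h
  refine dedekindPsi_lt_of_prod_lt hn0 ?_
  have hL : 0 ≤ log n := by linarith
  obtain ⟨x, hx⟩ : ∃ x, x = ⌊log (n : ℝ)⌋₊ := ⟨_, rfl⟩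
  have hx512 : 512 ≤ x := by rw [hx]; exact Nat.le_floor (by exact_mod_cast hn)
  have hxL : (x : ℝ) ≤ log n := by rw [hx]; exact Nat.floor_le hL
  have hLx : log n < x + 1 := by rw [hx]; exact Nat.lt_floor_add_one _
  have hx' : (512 : ℝ) ≤ x := by exact_mod_cast hx512
  have hlx : 6.238 ≤ log (x : ℝ) := by
    have := log_le_log (by norm_num) hx'
    rw [log_512] at this
    linarith [log_two_gt_d9]
  have hll : 0 < log (log n) := log_pos (by linarith)
  have h1 := sum_log_one_add_inv_le hn0 (show 2 ≤ x by omega)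
  have h2 := sum_log_one_add_inv_primesLE_le hx512
  have h3 : 1 / ((x + 1) * log x) * (log n - ∑ p ∈ x.primesLE, log (p : ℝ)) ≤ 0.17 := by
    have hs : 0 ≤ ∑ p ∈ x.primesLE, log (p : ℝ) := sum_nonneg fun p _ => log_natCast_nonneg p
    rw [one_div_mul_eq_div, div_le_iff₀ (by positivity)]
    nlinarith
  have h4 : log (log (x : ℝ)) ≤ log (log (log n)) :=
    log_le_log (by linarith) (log_le_log (by linarith) hxL)
  rw [← log_lt_log_iff (prod_pos fun p _ => by positivity) (by positivity),
    log_prod_one_add_inv, log_mul (exp_pos _).ne' hll.ne', log_exp]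
  linarith [eulerMascheroniConstant_gt]

lemma dedekindPsi_lt_of_lt_300 {n : ℕ} (hn : 30 < n) (hn' : n < 300) :
    dedekindPsi n < exp eulerMascheroniConstant * n * log (log n) := by
  have h60 : ∀ n < 60, 30 < n → n ≠ 42 →
      1 * ∏ p ∈ (range (n + 1)).filter (fun p => p ∣ n ∧ TrialPrime p), (p + 1) ≤
        2 * ∏ p ∈ (range (n + 1)).filter (fun p => p ∣ n ∧ TrialPrime p), p := by
    decide +kernel
  have h210 : ∀ n < 210, 30 < n →
      5 * ∏ p ∈ (range (n + 1)).filter (fun p => p ∣ n ∧ TrialPrime p), (p + 1) ≤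
        12 * ∏ p ∈ (range (n + 1)).filter (fun p => p ∣ n ∧ TrialPrime p), p := by
    decide +kernel
  have h300 : ∀ n < 300, 30 < n →
      35 * ∏ p ∈ (range (n + 1)).filter (fun p => p ∣ n ∧ TrialPrime p), (p + 1) ≤
        96 * ∏ p ∈ (range (n + 1)).filter (fun p => p ∣ n ∧ TrialPrime p), p := by
    decide +kernel
  rcases lt_or_ge n 210 with h | h
  · rcases lt_or_ge n 60 with h' | h'
    · rcases eq_or_ne n 42 with rfl | h42
      · exact dedekindPsi_lt_of_lt (m := 42) (j := 8) (k := 43) (a := 17) (b := 13) (u := 16)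
          (v := 7) (by norm_num) (by norm_num) (by norm_num) (by norm_num) (by norm_num)
          (by norm_num) (by norm_num) (by decide +kernel) le_rfl (by norm_num) (by norm_num)
          (by norm_num)
      · exact dedekindPsi_lt_of_lt (m := 31) (j := 3) (k := 14) (a := 7) (b := 6) (by omega)
          (by norm_num) (by norm_num) (by norm_num) (by norm_num) (by norm_num) (by norm_num)
          (h60 n h' hn h42) hn (by norm_num) (by norm_num) (by norm_num)
    · exact dedekindPsi_lt_of_lt (m := 60) (j := 4) (k := 23) (a := 11) (b := 8) (by omega)
        (by norm_num) (by norm_num) (by norm_num) (by norm_num) (by norm_num) (by norm_num)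
        (h210 n h hn) h' (by norm_num) (by norm_num) (by norm_num)
  · exact dedekindPsi_lt_of_lt (m := 210) (j := 1) (k := 7) (a := 11) (b := 7) (by omega)
      (by norm_num) (by norm_num) (by norm_num) (by norm_num) (by norm_num) (by norm_num)
      (h300 n hn' hn) h (by norm_num) (by norm_num) (by norm_num)

end DedekindPsi

open DedekindPsi in
/-- Solé–Planat (2011): for `n > 30`, `ψ(n) < e^γ n log log n`. -/
theorem sole_planat_psi_bound (n : ℕ) (hn : 30 < n) :
    dedekindPsi n <
      Real.exp Real.eulerMascheroniConstant * n * Real.log (Real.log n) := by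
  rcases lt_or_ge n 300 with h | h300
  · exact dedekindPsi_lt_of_lt_300 hn h
  rcases le_total n (∏ p ∈ (range (11 + 1)).filter TrialPrime, p) with h | h
  · exact dedekindPsi_lt_of_le_primorial (m := 300) (j := 1) (k := 8) (a := 65) (b := 38)
      (u := 29923) (v := 10000) (by norm_num) (by norm_num) (by norm_num) (by norm_num) (by norm_num)
      (by norm_num) (by norm_num) (by norm_num) (by decide +kernel) h300 h (by norm_num)
      (by norm_num) (by norm_num)
  have h11 : 2 ^ 11 ≤ n := le_trans (by decide +kernel) h
  rcases le_total n (∏ p ∈ (range (17 + 1)).filter TrialPrime, p) with h | h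
  · exact dedekindPsi_lt_of_le_primorial (m := 2 ^ 11) (j := 1) (k := 11) (a := 2) (b := 1)
      (u := 342) (v := 100) (by norm_num) (by norm_num) (by norm_num) (by norm_num) (by norm_num)
      (by norm_num) (by norm_num) (by norm_num) (by decide +kernel) h11 h (by norm_num)
      (by norm_num) (by norm_num)
  have h18 : 2 ^ 18 ≤ n := le_trans (by decide +kernel) h
  rcases le_total n (∏ p ∈ (range (43 + 1)).filter TrialPrime, p) with h | h
  · exact dedekindPsi_lt_of_le_primorial (m := 2 ^ 18) (j := 1) (k := 18) (a := 5) (b := 2)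
      (u := 431) (v := 100) (by norm_num) (by norm_num) (by norm_num) (by norm_num) (by norm_num)
      (by norm_num) (by norm_num) (by norm_num) (by decide +kernel) h18 h (by norm_num)
      (by norm_num) (by norm_num)
  have h53 : 2 ^ 53 ≤ n := le_trans (by decide +kernel) h
  rcases le_total n (∏ p ∈ (range (300 + 1)).filter TrialPrime, p) with h | h
  · exact dedekindPsi_lt_of_le_primorial (m := 2 ^ 53) (j := 1) (k := 53) (a := 18) (b := 5)
      (u := 6241) (v := 1000) (by norm_num) (by norm_num) (by norm_num) (by norm_num) (by norm_num)
      (by norm_num) (by norm_num) (by norm_num) (by decide +kernel) h53 h (by norm_num)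
      (by norm_num) (by norm_num)
  have h399 : 2 ^ 399 ≤ n := le_trans (by decide +kernel) h
  rcases le_total n (∏ p ∈ (range (800 + 1)).filter TrialPrime, p) with h | h
  · exact dedekindPsi_lt_of_le_primorial (m := 2 ^ 399) (j := 1) (k := 399) (a := 5) (b := 1)
      (u := 7270) (v := 1000) (by norm_num) (by norm_num) (by norm_num) (by norm_num) (by norm_num)
      (by norm_num) (by norm_num) (by norm_num) (by decide +kernel) h399 h (by norm_num)
      (by norm_num) (by norm_num)
  have h1095 : 2 ^ 1095 ≤ n := le_trans (by decide +kernel) h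
  refine dedekindPsi_lt_of_512_le_log ?_
  have := mul_log_two_le_log (j := 1) (by norm_num) (by positivity) h1095 (pow_one _).ge
  norm_num at this
  linarith [log_two_gt_d9]
end

section
/- For all integers x ≥ 2 and y ≥ 2, π(x)² + π(y)² ≤ (5/4)·π(x+y)², where π is the prime-counting function. -/
/-- Evaluate the argument to a numeral before applying `f`, in kernel reduction. -/
def strictApply (f : ℕ → ℕ) (a : ℕ) : ℕ := Nat.rec (f 0) (fun n _ => f n) (a + 1)

/-- The analogue of `strictApply` for Boolean-valued functions. -/
def strictCheck (f : ℕ → Bool) (a : ℕ) : Bool := Nat.rec (f 0) (fun n _ => f n) (a + 1)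

/-- `∑ i < 2 ^ k, f (a + i)`, by repeated halving. -/
def dyadicSum (f : ℕ → ℕ) : ℕ → ℕ → ℕ
  | 0, a => f a
  | k + 1, a => dyadicSum f k a + dyadicSum f k (a + 2 ^ k)

/-- `∑ r, (2 - gcd (b + r) P)` over the residues `r` modulo `30` coprime to `30`. For `30 ∣ b` and a
suitable factorial `P` this is the number of primes in `[b, b + 30)`. -/
def wheelCount (P b : ℕ) : ℕ :=
  (2 - Nat.gcd (b + 1) P) + ((2 - Nat.gcd (b + 7) P) + ((2 - Nat.gcd (b + 11) P) +
    ((2 - Nat.gcd (b + 13) P) + ((2 - Nat.gcd (b + 17) P) + ((2 - Nat.gcd (b + 19) P) +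
    ((2 - Nat.gcd (b + 23) P) + (2 - Nat.gcd (b + 29) P)))))))

/-- Consecutive entries `(g, c)`, `(h, d)` satisfy `h = g + s * 2 ^ k` and
`d = c + ∑ i < 2 ^ k, f (g / s + i)` for some `k`. -/
def checkIncrements (f : ℕ → ℕ) (s : ℕ) : List (ℕ × ℕ) → Bool
  | [] => true
  | (g, c) :: t => match t with
    | [] => true
    | (g', c') :: _ =>
      Nat.beq g' (g + s * 2 ^ Nat.log2 ((g' - g) / s)) &&
        (Nat.beq c' (c + dyadicSum f (Nat.log2 ((g' - g) / s)) (g / s)) &&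
          checkIncrements f s t)

/-- Apply `k` to the suffix headed by the last entry (of a list sorted by first components) whose
first component is at most `n`; the head is kept if no later entry qualifies. -/
def seekThen (n : ℕ) (k : List (ℕ × ℕ) → Bool) : List (ℕ × ℕ) → Bool
  | [] => false
  | p :: t => match t with
    | [] => k (p :: t)
    | q :: _ => bif Nat.ble q.1 n then seekThen n k t else k (p :: t)

/-- Check `4 (π x ^ 2 + π y ^ 2) ≤ 5 π (x + y) ^ 2` for `x` in a half-open interval whose endpoints
and bound on `π x` are the first three arguments, and `y` in each consecutive interval of the first
list up to the right endpoint, with the second list bounding `π (x + y)` from below. -/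
def checkRow (g g' c' : ℕ) : List (ℕ × ℕ) → List (ℕ × ℕ) → Bool
  | [], _ => false
  | (h, _) :: t, zs => match t with
    | [] => false
    | (h', d') :: _ =>
      seekThen (g + h + 1) (fun zs' =>
        match zs' with
        | [] => false
        | (_, e) :: _ =>
          Nat.ble (4 * (c' * c' + d' * d')) (5 * (e * e)) &&
            (Nat.ble g' h' || checkRow g g' c' t zs')) zs

/-- Run `checkRow` with all intervals of the table `T` for `y`, for each interval of the list
below `N`. -/
def checkTable (T : List (ℕ × ℕ)) (N : ℕ) : List (ℕ × ℕ) → Bool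
  | [] => false
  | (g, c) :: t => Nat.ble N g || match t with
    | [] => false
    | (g', c') :: _ => checkRow g g' c' T ((g, c) :: t) && checkTable T N t

/-- Entries `(g, c)` where `c` is the number of primes below `g`. -/
def primeCountTable : List (ℕ × ℕ) :=
  [(2, 0), (3, 1), (4, 2), (5, 2), (6, 3), (7, 3), (8, 4), (9, 4), (10, 4), (11, 4), (12, 5),
  (13, 5), (14, 6), (15, 6), (16, 6), (17, 6), (18, 7), (19, 7), (20, 8), (21, 8), (22, 8),
  (23, 8), (24, 9), (25, 9), (26, 9), (27, 9), (28, 9), (29, 9), (30, 10), (31, 10), (32, 11),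
  (33, 11), (34, 11), (36, 11), (38, 12), (40, 12), (42, 13), (44, 14), (46, 14), (48, 15),
  (50, 15), (52, 15), (54, 16), (56, 16), (58, 16), (60, 17), (62, 18), (64, 18), (66, 18),
  (68, 19), (72, 20), (76, 21), (80, 22), (84, 23), (88, 23), (92, 24), (96, 24), (100, 25),
  (104, 27), (108, 28), (112, 29), (116, 30), (120, 30), (124, 30), (128, 31), (132, 32),
  (136, 32), (144, 34), (152, 36), (160, 37), (168, 39), (176, 40), (184, 42), (192, 43),
  (200, 46), (208, 46), (216, 47), (224, 48), (232, 50), (240, 52), (248, 53), (256, 54),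
  (264, 56), (272, 58), (288, 61), (304, 62), (320, 66), (336, 67), (352, 70), (368, 73),
  (384, 76), (400, 78), (416, 80), (432, 83), (448, 86), (464, 90), (480, 92), (496, 94),
  (512, 97), (528, 99), (544, 100), (576, 105), (608, 111), (640, 115), (672, 121), (704, 126),
  (736, 130), (768, 135), (800, 139), (832, 145), (864, 150), (896, 154), (928, 157), (960, 162),
  (992, 167), (1008, 168), (1016, 170), (1020, 171), (1080, 180), (1140, 189), (1260, 205),
  (1380, 220), (1500, 239), (1620, 256), (1740, 270), (1860, 283), (1980, 299), (2100, 317),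
  (2220, 330), (2460, 364), (2700, 393), (2940, 424), (3180, 449), (3420, 480), (3660, 511),
  (3900, 539), (4140, 570), (4380, 597), (4860, 650), (5340, 706), (5820, 763), (6300, 819),
  (6780, 872), (7260, 928), (7740, 981), (8220, 1030), (8700, 1084), (9180, 1137), (10140, 1244),
  (11100, 1345), (12060, 1444), (13020, 1551), (13980, 1650), (14940, 1749), (15900, 1852),
  (16860, 1944), (17820, 2043), (19740, 2234), (21660, 2431), (23580, 2622), (25500, 2810),
  (27420, 2996), (29340, 3188), (31260, 3370), (33180, 3555), (35100, 3742), (38940, 4102),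
  (42780, 4473), (46620, 4817), (50460, 5177), (54300, 5523), (58140, 5886), (61980, 6229),
  (65820, 6573), (69660, 6907), (73500, 7257), (81180, 7945), (88860, 8607), (96540, 9297),
  (104220, 9953), (111900, 10612), (119580, 11260), (127260, 11920), (134940, 12572),
  (142620, 13237), (157980, 14519), (173340, 15780), (188700, 17054), (204060, 18310),
  (219420, 19560), (234780, 20811), (250140, 22057), (265500, 23270), (280860, 24503),
  (311580, 26921), (342300, 29368), (373020, 31752), (403740, 34133), (434460, 36520),
  (465180, 38860), (495900, 41228), (526620, 43570), (557340, 45876), (588060, 48214),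
  (649500, 52785), (710940, 57378)]

theorem strictApply_eq (f : ℕ → ℕ) (a : ℕ) : strictApply f a = f a := rfl

theorem strictCheck_eq (f : ℕ → Bool) (a : ℕ) : strictCheck f a = f a := rfl

theorem dyadicSum_eq_sum (f : ℕ → ℕ) (k a : ℕ) :
    dyadicSum f k a = ∑ i ∈ Finset.range (2 ^ k), f (a + i) := by
  induction k generalizing a with
  | zero => simp [dyadicSum]
  | succ k ih =>
    rw [dyadicSum, ih, ih, pow_succ, mul_two, Finset.sum_range_add]
    simp only [add_assoc]

theorem two_sub_gcd_factorial {M n : ℕ} (hM : 1 ≤ M) (hMn : M < n) (hn : n < (M + 1) ^ 2) :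
    2 - Nat.gcd n M.factorial = if n.Prime then 1 else 0 := by
  split_ifs with hp
  · have : Nat.gcd n M.factorial = 1 :=
      (Nat.Prime.coprime_iff_not_dvd hp).2 fun h => by
        have := (Nat.Prime.dvd_factorial hp).1 h
        omega
    rw [this]
  · have hq : (Nat.minFac n).Prime := Nat.minFac_prime (by omega)
    have hsq : Nat.minFac n ^ 2 ≤ n := Nat.minFac_sq_le_self (by omega) hp
    have hle : Nat.minFac n ≤ M := by
      have := lt_of_pow_lt_pow_left₀ 2 (by omega) (hsq.trans_lt hn)
      omega
    have hdvd : Nat.minFac n ∣ Nat.gcd n M.factorial :=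
      Nat.dvd_gcd (Nat.minFac_dvd n) ((Nat.Prime.dvd_factorial hq).2 hle)
    have := Nat.le_of_dvd (Nat.gcd_pos_of_pos_left _ (by omega)) hdvd
    have := hq.two_le
    omega

theorem count_prime_wheel {M b : ℕ} (hM : 5 ≤ M) (hb : 30 ∣ b) (hMb : M ≤ b)
    (hb' : b + 30 ≤ (M + 1) ^ 2) :
    Nat.count Nat.Prime (b + 30) = Nat.count Nat.Prime b + wheelCount M.factorial b := by
  have key : ∀ r, 1 ≤ r → r < 30 → 2 - Nat.gcd (b + r) M.factorial =
      if (b + r).Prime then 1 else 0 := fun r h1 h2 =>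
    two_sub_gcd_factorial (by omega) (by omega) (by omega)
  have notPrime : ∀ r, (2 ∣ r ∨ 3 ∣ r ∨ 5 ∣ r) → ¬ (b + r).Prime := by
    rintro r (h | h | h) hp
    · exact absurd ((Nat.prime_dvd_prime_iff_eq Nat.prime_two hp).1 (by omega)) (by omega)
    · exact absurd ((Nat.prime_dvd_prime_iff_eq Nat.prime_three hp).1 (by omega)) (by omega)
    · exact absurd ((Nat.prime_dvd_prime_iff_eq Nat.prime_five hp).1 (by omega)) (by omega)
  have h0 := notPrime 0 (by norm_num)
  rw [add_zero] at h0
  rw [Nat.count_add]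
  simp only [wheelCount, key 1 (by norm_num) (by norm_num), key 7 (by norm_num) (by norm_num),
    key 11 (by norm_num) (by norm_num), key 13 (by norm_num) (by norm_num),
    key 17 (by norm_num) (by norm_num), key 19 (by norm_num) (by norm_num),
    key 23 (by norm_num) (by norm_num), key 29 (by norm_num) (by norm_num)]
  simp [Nat.count_succ, h0, notPrime]
  ring

theorem count_eq_of_checkIncrements {f : ℕ → ℕ} {s L U : ℕ} (hs : 0 < s)
    (hf : ∀ a, L ≤ s * a → s * (a + 1) ≤ U →
      Nat.count Nat.Prime (s * (a + 1)) = Nat.count Nat.Prime (s * a) + f a)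
    (l : List (ℕ × ℕ)) (hl : checkIncrements f s l = true) (hU : ∀ p ∈ l, p.1 ≤ U)
    (hhead : ∀ p ∈ l.head?, L ≤ p.1 ∧ s ∣ p.1 ∧ Nat.count Nat.Prime p.1 = p.2) :
    ∀ p ∈ l, Nat.count Nat.Prime p.1 = p.2 := by
  induction l with
  | nil => simp
  | cons p t ih =>
    obtain ⟨g, c⟩ := p
    obtain ⟨hL, ⟨a, rfl⟩, hc⟩ := hhead (g, c) (by simp)
    have htail : ∀ p ∈ t, Nat.count Nat.Prime p.1 = p.2 := by
      cases t with
      | nil => simp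
      | cons q t =>
        obtain ⟨g', c'⟩ := q
        simp only [checkIncrements, Bool.and_eq_true, Nat.beq_eq] at hl
        set k := Nat.log2 ((g' - s * a) / s)
        obtain ⟨hg', hc', hrec⟩ := hl
        have hgU := hU (g', c') (by simp)
        simp only at hL hc hgU
        have hcount : ∀ n ≤ 2 ^ k, Nat.count Nat.Prime (s * (a + n)) =
            Nat.count Nat.Prime (s * a) + ∑ i ∈ Finset.range n, f (a + i) := by
          intro n
          induction n with
          | zero => simp
          | succ n ihn =>
            intro hn
            rw [Finset.sum_range_succ, ← add_assoc, ← add_assoc, ← ihn (by omega)]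
            refine hf _ (hL.trans (Nat.mul_le_mul_left s (Nat.le_add_right a n))) ?_
            calc s * (a + n + 1) ≤ s * (a + 2 ^ k) := Nat.mul_le_mul_left s (by omega)
              _ ≤ U := by rw [mul_add, ← hg']; exact hgU
        refine ih ?_ (fun p hp => hU p (by simp [hp])) ?_
        · simpa only [checkIncrements] using hrec
        · intro p hp
          simp only [List.head?_cons, Option.mem_def, Option.some.injEq] at hp
          subst hp
          refine ⟨?_, ?_, ?_⟩
          · simp only; omega
          · simp only [hg']; exact ⟨a + 2 ^ k, by ring⟩
          · have := hcount _ le_rfl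
            simp only
            rw [hg', ← mul_add, this, hc, hc', dyadicSum_eq_sum, Nat.mul_div_cancel_left _ hs]
    intro p hp
    rcases List.mem_cons.1 hp with rfl | hp
    · exact hc
    · exact htail p hp

theorem exists_of_seekThen {n m : ℕ} (hnm : n ≤ m) {k : List (ℕ × ℕ) → Bool}
    {l : List (ℕ × ℕ)} (h : seekThen n k l = true) (hhead : ∀ p ∈ l.head?, p.1 ≤ m) :
    ∃ l', l' <:+ l ∧ (∀ p ∈ l'.head?, p.1 ≤ m) ∧ k l' = true := by
  induction l with
  | nil => simp [seekThen] at h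
  | cons p t ih =>
    cases t with
    | nil => exact ⟨[p], List.suffix_rfl, hhead, by simpa [seekThen] using h⟩
    | cons q t =>
      rw [seekThen] at h
      cases hq : Nat.ble q.1 n with
      | true =>
        rw [hq, cond_true] at h
        obtain ⟨l', h1, h2, h3⟩ := ih h (by simpa using (Nat.le_of_ble_eq_true hq).trans hnm)
        exact ⟨l', h1.trans (List.suffix_cons _ _), h2, h3⟩
      | false =>
        rw [hq, cond_false] at h
        exact ⟨_, List.suffix_rfl, hhead, h⟩

theorem sq_add_sq_le_of_checkRow {g g' c' x y : ℕ} (hgx : g ≤ x) (hxg : x < g') (hyx : y ≤ x)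
    (hc' : Nat.primeCounting x ≤ c') (ys : List (ℕ × ℕ)) :
    ∀ zs : List (ℕ × ℕ), checkRow g g' c' ys zs = true →
    (∀ p ∈ ys, Nat.count Nat.Prime p.1 = p.2) → (∀ p ∈ zs, Nat.count Nat.Prime p.1 = p.2) →
    (∀ p ∈ zs.head?, p.1 ≤ g + y + 1) → (∀ q ∈ ys.head?, q.1 ≤ y) →
    4 * (Nat.primeCounting x ^ 2 + Nat.primeCounting y ^ 2) ≤
      5 * Nat.primeCounting (x + y) ^ 2 := by
  induction ys with
  | nil => simp [checkRow]
  | cons p t ih =>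
    intro zs hrow hys hzs hzhead hyhead
    obtain ⟨h, d⟩ := p
    cases t with
    | nil => simp [checkRow] at hrow
    | cons q t =>
      obtain ⟨h', d'⟩ := q
      have hhy : h ≤ y := by simpa using hyhead
      rw [checkRow] at hrow
      obtain ⟨zs', hsuf, hhead', hk⟩ := exists_of_seekThen (by omega) hrow hzhead
      cases zs' with
      | nil => simp at hk
      | cons r zs' =>
        obtain ⟨z, e⟩ := r
        simp only [Bool.and_eq_true, Bool.or_eq_true, Nat.ble_eq] at hk
        obtain ⟨hle, hk⟩ := hk
        have hz : z ≤ g + y + 1 := by simpa using hhead'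
        by_cases hyh : y < h'
        · have he : Nat.count Nat.Prime z = e := hzs (z, e) (hsuf.subset (by simp))
          have hd : Nat.count Nat.Prime h' = d' := hys (h', d') (by simp)
          have h1 : Nat.primeCounting y ≤ d' := hd ▸ Nat.count_monotone Nat.Prime hyh
          have h2 : e ≤ Nat.primeCounting (x + y) :=
            he ▸ Nat.count_monotone Nat.Prime (show z ≤ x + y + 1 by omega)
          calc 4 * (Nat.primeCounting x ^ 2 + Nat.primeCounting y ^ 2)
              ≤ 4 * (c' ^ 2 + d' ^ 2) := by gcongr
            _ ≤ 5 * e ^ 2 := by simpa only [sq] using hle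
            _ ≤ _ := by gcongr
        · have hrec := hk.resolve_left (by omega)
          exact ih _ hrec (fun p hp => hys p (List.mem_cons_of_mem _ hp))
            (fun p hp => hzs p (hsuf.subset hp)) hhead' (by simpa using hyh)

theorem sq_add_sq_le_of_checkTable {T : List (ℕ × ℕ)} {N y : ℕ} (hy : ∀ p ∈ T.head?, p.1 ≤ y)
    (hT : ∀ p ∈ T, Nat.count Nat.Prime p.1 = p.2)
    (l : List (ℕ × ℕ)) (hl : checkTable T N l = true)
    (hlT : ∀ p ∈ l, Nat.count Nat.Prime p.1 = p.2) :
    ∀ x < N, (∀ p ∈ l.head?, p.1 ≤ x) → y ≤ x →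
    4 * (Nat.primeCounting x ^ 2 + Nat.primeCounting y ^ 2) ≤
      5 * Nat.primeCounting (x + y) ^ 2 := by
  induction l with
  | nil => simp [checkTable] at hl
  | cons p t ih =>
    intro x hxN hhead hyx
    obtain ⟨g, c⟩ := p
    have hgx : g ≤ x := by simpa using hhead
    rw [checkTable.eq_def] at hl
    simp only [Bool.or_eq_true, Nat.ble_eq] at hl
    have hl := hl.resolve_left (by omega)
    cases t with
    | nil => simp at hl
    | cons q t =>
      obtain ⟨g', c'⟩ := q
      simp only [Bool.and_eq_true] at hl
      by_cases hxg : x < g'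
      · have hc' : Nat.count Nat.Prime g' = c' := hlT (g', c') (by simp)
        exact sq_add_sq_le_of_checkRow hgx hxg hyx
          (hc' ▸ Nat.count_monotone Nat.Prime (show x + 1 ≤ g' from hxg)) T _ hl.1 hT hlT
          (by simp; omega) hy
      · exact ih hl.2 (fun p hp => hlT p (List.mem_cons_of_mem _ hp)) x hxN (by simpa using hxg) hyx

theorem count_prime_of_mem_primeCountTable :
    ∀ p ∈ primeCountTable, Nat.count Nat.Prime p.1 = p.2 := by
  have h₁ : ∀ p ∈ primeCountTable.take 31, Nat.count Nat.Prime p.1 = p.2 := by decide +kernel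
  have h₂ : ∀ p ∈ (primeCountTable.drop 30).take 88, Nat.count Nat.Prime p.1 = p.2 := by
    refine count_eq_of_checkIncrements (f := strictApply fun n => 2 - Nat.gcd n (Nat.factorial 31))
      (s := 1) (L := 32) (U := 1020) one_pos ?_ _ ?_ ?_ ?_
    · intro a h1 h2
      rw [strictApply_eq, one_mul, one_mul, two_sub_gcd_factorial (by norm_num) (by omega)
        (by norm_num; omega), Nat.count_succ]
    · rw [← strictCheck_eq (fun P => checkIncrements (strictApply fun n => 2 - Nat.gcd n P) 1 _)]
      decide +kernel
    · decide +kernel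
    · intro p hp
      have : p = (32, 11) := by
        have h : (List.take 88 (List.drop 30 primeCountTable)).head? = some (32, 11) := by
          decide +kernel
        rw [h] at hp
        exact (Option.some.inj hp).symm
      subst this
      exact ⟨le_rfl, one_dvd _, h₁ _ (by decide +kernel)⟩
  have h₃ : ∀ p ∈ primeCountTable.drop 117, Nat.count Nat.Prime p.1 = p.2 := by
    refine count_eq_of_checkIncrements
      (f := strictApply fun n => wheelCount (Nat.factorial 850) (30 * n))
      (s := 30) (L := 1020) (U := 720000) (by norm_num) ?_ _ ?_ ?_ ?_
    · intro a h1 h2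
      rw [strictApply_eq, mul_add_one, count_prime_wheel (M := 850) (by norm_num) (dvd_mul_right _ _)
        (by omega) (by omega)]
    · rw [← strictCheck_eq
        (fun P => checkIncrements (strictApply fun n => wheelCount P (30 * n)) 30 _)]
      decide +kernel
    · decide +kernel
    · intro p hp
      have : p = (1020, 171) := by
        have h : (List.drop 117 primeCountTable).head? = some (1020, 171) := by decide +kernel
        rw [h] at hp
        exact (Option.some.inj hp).symm
      subst this
      exact ⟨le_rfl, by norm_num, h₂ _ (by decide +kernel)⟩
  intro p hp
  have hsplit : ∀ p ∈ primeCountTable, p ∈ primeCountTable.take 31 ∨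
      p ∈ (primeCountTable.drop 30).take 88 ∨ p ∈ primeCountTable.drop 117 := by decide +kernel
  rcases hsplit p hp with hp | hp | hp
  exacts [h₁ p hp, h₂ p hp, h₃ p hp]

theorem sq_add_sq_le_of_lt {x y : ℕ} (hy : 2 ≤ y) (hyx : y ≤ x) (hx : x < 500000) :
    4 * (Nat.primeCounting x ^ 2 + Nat.primeCounting y ^ 2) ≤
      5 * Nat.primeCounting (x + y) ^ 2 := by
  have hhead : primeCountTable.head? = some (2, 0) := by decide +kernel
  refine sq_add_sq_le_of_checkTable (T := primeCountTable) (N := 500000) ?_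
    count_prime_of_mem_primeCountTable primeCountTable (by decide +kernel)
    count_prime_of_mem_primeCountTable x hx ?_ hyx
  all_goals
    intro p hp
    rw [hhead] at hp
    cases hp
    simp only
    omega

theorem log_factorial_eq_sum_vonMangoldt (N : ℕ) :
    Real.log (N.factorial : ℝ) =
      ∑ d ∈ Finset.Ioc 0 N, ArithmeticFunction.vonMangoldt d * ((N / d : ℕ) : ℝ) := by
  rw [← ArithmeticFunction.sum_Ioc_mul_zeta_eq_sum, ArithmeticFunction.vonMangoldt_mul_zeta]
  induction N with
  | zero => simp
  | succ n ih =>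
    rw [Finset.sum_Ioc_succ_top (Nat.zero_le n), ← ih, Nat.factorial_succ, Nat.cast_mul,
      Real.log_mul (by positivity) (by positivity), ArithmeticFunction.log_apply, add_comm]

theorem log_factorial_div_eq_sum_vonMangoldt (N k : ℕ) :
    Real.log ((N / k).factorial : ℝ) =
      ∑ d ∈ Finset.Ioc 0 N, ArithmeticFunction.vonMangoldt d * ((N / d / k : ℕ) : ℝ) := by
  rw [log_factorial_eq_sum_vonMangoldt]
  have hcomm : ∀ d, N / k / d = N / d / k := fun d => by
    rw [Nat.div_div_eq_div_mul, Nat.div_div_eq_div_mul, mul_comm]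
  simp_rw [hcomm]
  refine Finset.sum_subset (Finset.Ioc_subset_Ioc_right (Nat.div_le_self N k)) fun d hd hd' => ?_
  have hlt : N / k < d := by
    simp only [Finset.mem_Ioc] at hd hd'
    omega
  rw [← hcomm, Nat.div_eq_of_lt hlt]
  simp

theorem log_factorial_le (n : ℕ) (hn : 1 ≤ n) :
    Real.log (n.factorial : ℝ) ≤ n * Real.log n - n + Real.log n + 1 := by
  induction n, hn using Nat.le_induction with
  | base => simp
  | succ n hn ih =>
    have hn0 : (0 : ℝ) < n := by exact_mod_cast hn
    have hratio := Real.one_sub_inv_le_log_of_pos (x := ((n : ℝ) + 1) / n) (by positivity)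
    rw [Real.log_div (by positivity) (by positivity)] at hratio
    have hmul : (1 : ℝ) ≤ (n + 1) * (Real.log (n + 1) - Real.log n) := by
      have heq : ((n : ℝ) + 1) * (1 - (((n : ℝ) + 1) / n)⁻¹) = 1 := by
        field_simp
        ring
      calc (1 : ℝ) = (n + 1) * (1 - (((n : ℝ) + 1) / n)⁻¹) := heq.symm
        _ ≤ (n + 1) * (Real.log (n + 1) - Real.log n) := by gcongr
    rw [Nat.factorial_succ, Nat.cast_mul, Real.log_mul (by positivity) (by positivity)]
    push_cast
    linarith

theorem le_log_factorial (n : ℕ) : n * Real.log n - n ≤ Real.log (n.factorial : ℝ) := by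
  rcases Nat.eq_zero_or_pos n with rfl | hn
  · simp
  · have hstirling := Stirling.le_log_factorial_stirling hn.ne'
    have h1 : 0 ≤ Real.log (n : ℝ) := Real.log_natCast_nonneg n
    have h2 : 0 ≤ Real.log (2 * Real.pi) := Real.log_nonneg (by linarith [Real.pi_gt_three])
    linarith

theorem log_floor_factorial_bounds {u : ℝ} (hu : 1 ≤ u) :
    u * Real.log u - u - Real.log u ≤ Real.log (⌊u⌋₊.factorial : ℝ) ∧
      Real.log (⌊u⌋₊.factorial : ℝ) ≤ u * Real.log u - u + Real.log u + 1 := by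
  have hn : 1 ≤ ⌊u⌋₊ := (Nat.one_le_floor_iff u).mpr hu
  have hle : (⌊u⌋₊ : ℝ) ≤ u := Nat.floor_le (by linarith)
  have hlt : u < ⌊u⌋₊ + 1 := Nat.lt_floor_add_one u
  have hlower := le_log_factorial ⌊u⌋₊
  have hupper := log_factorial_le ⌊u⌋₊ hn
  generalize ⌊u⌋₊ = n at *
  have hn1 : (1 : ℝ) ≤ n := by exact_mod_cast hn
  have hn0 : (0 : ℝ) < n := by linarith
  have hu0 : 0 < u := by linarith
  have hlogn : 0 ≤ Real.log (n : ℝ) := Real.log_nonneg hn1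
  have hlogu : 0 ≤ Real.log u := Real.log_nonneg hu
  have hloglt : Real.log (n : ℝ) ≤ Real.log u := Real.log_le_log hn0 hle
  have hup := Real.log_le_sub_one_of_pos (x := u / n) (by positivity)
  have hlow := Real.one_sub_inv_le_log_of_pos (x := u / n) (by positivity)
  rw [Real.log_div hu0.ne' hn0.ne'] at hup hlow
  have hup' : n * (Real.log u - Real.log n) ≤ u - n := by
    calc n * (Real.log u - Real.log n) ≤ n * (u / n - 1) := by gcongr
      _ = u - n := by field_simp
  have hlow' : u - n ≤ u * (Real.log u - Real.log n) := by
    calc u - n = u * (1 - (u / n)⁻¹) := by field_simp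
      _ ≤ u * (Real.log u - Real.log n) := by gcongr
  constructor
  · nlinarith [mul_nonneg (by linarith : (0 : ℝ) ≤ n + 1 - u) hlogu]
  · nlinarith [mul_nonneg (by linarith : (0 : ℝ) ≤ u - n) hlogn]

/-- Chebyshev's alternating sum of factorial logarithms. -/
noncomputable def chebyshevSum (N : ℕ) : ℝ :=
  Real.log (N.factorial : ℝ) - Real.log ((N / 2).factorial : ℝ)
    - Real.log ((N / 3).factorial : ℝ) - Real.log ((N / 5).factorial : ℝ)
    + Real.log ((N / 30).factorial : ℝ)

/-- Chebyshev's constant, `0.92129…`. -/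
noncomputable def chebyshevConst : ℝ :=
  Real.log 2 / 2 + Real.log 3 / 3 + Real.log 5 / 5 - Real.log 30 / 30

theorem log_thirty_eq : Real.log 30 = Real.log 2 + Real.log 3 + Real.log 5 := by
  rw [← Real.log_mul (by norm_num) (by norm_num), ← Real.log_mul (by norm_num) (by norm_num)]
  norm_num

theorem chebyshevConst_mem : chebyshevConst ∈ Set.Ioo (0.92129 : ℝ) 0.9213 := by
  have h2 := Real.log_two_gt_d9
  have h2' := Real.log_two_lt_d9
  have h3 := Real.log_three_gt_d9
  have h3' := Real.log_three_lt_d9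
  have h5 := Real.log_five_gt_d9
  have h5' := Real.log_five_lt_d9
  rw [chebyshevConst, log_thirty_eq, Set.mem_Ioo]
  constructor <;> linarith

theorem chebyshevSum_eq_sum (N : ℕ) :
    chebyshevSum N = ∑ d ∈ Finset.Ioc 0 N, ArithmeticFunction.vonMangoldt d *
      (((N / d : ℕ) : ℝ) - ((N / d / 2 : ℕ) : ℝ) - ((N / d / 3 : ℕ) : ℝ)
        - ((N / d / 5 : ℕ) : ℝ) + ((N / d / 30 : ℕ) : ℝ)) := by
  rw [chebyshevSum, log_factorial_eq_sum_vonMangoldt N, log_factorial_div_eq_sum_vonMangoldt N 2,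
    log_factorial_div_eq_sum_vonMangoldt N 3, log_factorial_div_eq_sum_vonMangoldt N 5,
    log_factorial_div_eq_sum_vonMangoldt N 30, ← Finset.sum_sub_distrib,
    ← Finset.sum_sub_distrib, ← Finset.sum_sub_distrib, ← Finset.sum_add_distrib]
  exact Finset.sum_congr rfl fun d _ => by ring

theorem psi_natCast (N : ℕ) :
    Chebyshev.psi (N : ℝ) = ∑ d ∈ Finset.Ioc 0 N, ArithmeticFunction.vonMangoldt d := by
  rw [Chebyshev.psi, Nat.floor_natCast]

theorem chebyshevSum_le_psi (N : ℕ) : chebyshevSum N ≤ Chebyshev.psi (N : ℝ) := by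
  rw [chebyshevSum_eq_sum, psi_natCast]
  refine Finset.sum_le_sum fun d _ => ?_
  have hcoeff : N / d + N / d / 30 ≤ 1 + N / d / 2 + N / d / 3 + N / d / 5 := by omega
  have hcoeff' : ((N / d : ℕ) : ℝ) + ((N / d / 30 : ℕ) : ℝ) ≤
      1 + ((N / d / 2 : ℕ) : ℝ) + ((N / d / 3 : ℕ) : ℝ) + ((N / d / 5 : ℕ) : ℝ) := by
    exact_mod_cast hcoeff
  exact mul_le_of_le_one_right ArithmeticFunction.vonMangoldt_nonneg (by linarith)

theorem psi_sub_psi_div_six_le_chebyshevSum (N : ℕ) :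
    Chebyshev.psi (N : ℝ) - Chebyshev.psi ((N / 6 : ℕ) : ℝ) ≤ chebyshevSum N := by
  have hsplit (f : ℕ → ℝ) :=
    Finset.sum_Ioc_consecutive f (Nat.zero_le (N / 6)) (Nat.div_le_self N 6)
  rw [chebyshevSum_eq_sum, psi_natCast, psi_natCast, ← hsplit ArithmeticFunction.vonMangoldt,
    ← hsplit, add_sub_cancel_left]
  have hfirst : 0 ≤ ∑ d ∈ Finset.Ioc 0 (N / 6), ArithmeticFunction.vonMangoldt d *
      (((N / d : ℕ) : ℝ) - ((N / d / 2 : ℕ) : ℝ) - ((N / d / 3 : ℕ) : ℝ)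
        - ((N / d / 5 : ℕ) : ℝ) + ((N / d / 30 : ℕ) : ℝ)) := by
    refine Finset.sum_nonneg fun d _ => ?_
    have hcoeff : N / d / 2 + N / d / 3 + N / d / 5 ≤ N / d + N / d / 30 := by omega
    have hcoeff' : ((N / d / 2 : ℕ) : ℝ) + ((N / d / 3 : ℕ) : ℝ) + ((N / d / 5 : ℕ) : ℝ) ≤
        ((N / d : ℕ) : ℝ) + ((N / d / 30 : ℕ) : ℝ) := by
      exact_mod_cast hcoeff
    exact mul_nonneg ArithmeticFunction.vonMangoldt_nonneg (by linarith)
  refine le_add_of_nonneg_of_le hfirst (Finset.sum_le_sum fun d hd => ?_)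
  have hmem := Finset.mem_Ioc.mp hd
  have hd0 : 0 < d := by omega
  have hpos : 1 ≤ N / d := (Nat.one_le_div_iff hd0).mpr hmem.2
  have hsix : N / d < 6 := by
    rw [Nat.div_lt_iff_lt_mul hd0]
    omega
  have hcoeff : 1 + N / d / 2 + N / d / 3 + N / d / 5 ≤ N / d + N / d / 30 := by omega
  have hcoeff' : 1 + ((N / d / 2 : ℕ) : ℝ) + ((N / d / 3 : ℕ) : ℝ) + ((N / d / 5 : ℕ) : ℝ) ≤
      ((N / d : ℕ) : ℝ) + ((N / d / 30 : ℕ) : ℝ) := by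
    exact_mod_cast hcoeff
  exact le_mul_of_one_le_right ArithmeticFunction.vonMangoldt_nonneg (by linarith)

theorem log_factorial_div_bounds {N k : ℕ} (hk : 1 ≤ k) (hkN : k ≤ N) :
    (N / k : ℝ) * (Real.log N - Real.log k) - N / k - (Real.log N - Real.log k) ≤
        Real.log ((N / k).factorial : ℝ) ∧
      Real.log ((N / k).factorial : ℝ) ≤
        (N / k : ℝ) * (Real.log N - Real.log k) - N / k + (Real.log N - Real.log k) + 1 := by
  have hk0 : (0 : ℝ) < k := by exact_mod_cast hk
  have hN0 : (0 : ℝ) < N := by exact_mod_cast (hk.trans hkN)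
  have hbounds := log_floor_factorial_bounds (u := (N : ℝ) / k)
    ((one_le_div hk0).mpr (by exact_mod_cast hkN))
  rwa [Nat.floor_div_eq_div, Real.log_div hN0.ne' hk0.ne'] at hbounds

theorem abs_chebyshevSum_sub_le {N : ℕ} (hN : 30 ≤ N) :
    |chebyshevSum N - chebyshevConst * N| ≤ 5 * Real.log N := by
  have h1 := log_factorial_div_bounds (N := N) (k := 1) le_rfl (by omega)
  have h2 := log_factorial_div_bounds (N := N) (k := 2) (by omega) (by omega)
  have h3 := log_factorial_div_bounds (N := N) (k := 3) (by omega) (by omega)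
  have h5 := log_factorial_div_bounds (N := N) (k := 5) (by omega) (by omega)
  have h30 := log_factorial_div_bounds (N := N) (k := 30) (by omega) hN
  push_cast at h1 h2 h3 h5 h30
  simp only [Nat.div_one, Real.log_one, sub_zero, div_one] at h1
  have hlog2 := Real.log_two_gt_d9
  have hlog3 := Real.log_three_gt_d9
  have hlog5 := Real.log_five_gt_d9
  rw [log_thirty_eq] at h30
  rw [abs_le, chebyshevSum, chebyshevConst, log_thirty_eq]
  constructor
  · linarith [h1.1, h2.2, h3.2, h5.2, h30.1]
  · linarith [h1.2, h2.1, h3.1, h5.1, h30.2]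

theorem psi_ge {N : ℕ} (hN : 30 ≤ N) :
    chebyshevConst * N - 5 * Real.log N ≤ Chebyshev.psi (N : ℝ) := by
  have habs := (abs_le.mp (abs_chebyshevSum_sub_le hN)).1
  linarith [chebyshevSum_le_psi N]

theorem psi_le {N : ℕ} (hN : 1 ≤ N) :
    Chebyshev.psi (N : ℝ) ≤ 1.2 * chebyshevConst * N + 2 * (Real.log N + 1) ^ 2 + 30 := by
  have hA := chebyshevConst_mem
  induction N using Nat.strong_induction_on with
  | _ N ih =>
  have hN0 : (0 : ℝ) < N := by exact_mod_cast hN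
  have hlog : 0 ≤ Real.log (N : ℝ) := Real.log_natCast_nonneg N
  rcases lt_or_ge N 30 with hsmall | hlarge
  · have hpi : Nat.primeCounting N ≤ 10 := by
      refine (Nat.monotone_primeCounting (by omega : N ≤ 29)).trans ?_
      decide
    have hpi' : (Nat.primeCounting N : ℝ) ≤ 10 := by exact_mod_cast hpi
    have hpsi := Chebyshev.psi_le_primeCounting_mul_log N
    have hmain : 0 ≤ 1.2 * chebyshevConst * N := by
      have := hA.1
      positivity
    nlinarith [mul_le_mul_of_nonneg_right hpi' hlog, sq_nonneg (Real.log (N : ℝ) - 2)]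
  · have hdiv : 1 ≤ N / 6 := by omega
    have hrec := ih (N / 6) (by omega) hdiv
    have hstep := psi_sub_psi_div_six_le_chebyshevSum N
    have habs := (abs_le.mp (abs_chebyshevSum_sub_le hlarge)).2
    have hcast : ((N / 6 : ℕ) : ℝ) ≤ N / 6 := Nat.cast_div_le
    have hdiv0 : (1 : ℝ) ≤ ((N / 6 : ℕ) : ℝ) := by exact_mod_cast hdiv
    have hlogdiv0 : 0 ≤ Real.log ((N / 6 : ℕ) : ℝ) := Real.log_nonneg hdiv0
    have hlogdiv : Real.log ((N / 6 : ℕ) : ℝ) ≤ Real.log N - 1.79 := by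
      have hmono := Real.log_le_log (by linarith) hcast
      have hlog6 : Real.log 6 = Real.log 2 + Real.log 3 := by
        rw [← Real.log_mul (by norm_num) (by norm_num)]
        norm_num
      rw [Real.log_div hN0.ne' (by norm_num), hlog6] at hmono
      linarith [Real.log_two_gt_d9, Real.log_three_gt_d9]
    have hsq : (Real.log ((N / 6 : ℕ) : ℝ) + 1) ^ 2 ≤ (Real.log N - 0.79) ^ 2 := by
      gcongr
      linarith
    have hlin : 1.2 * chebyshevConst * ((N / 6 : ℕ) : ℝ) ≤ 1.2 * chebyshevConst * (N / 6) := by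
      have := hA.1
      gcongr
    nlinarith

theorem theta_le {t : ℝ} (ht : 1 ≤ t) :
    Chebyshev.theta t ≤ 1.10556 * t + 2 * (Real.log t + 1) ^ 2 + 30 := by
  have hfloor : 1 ≤ ⌊t⌋₊ := (Nat.one_le_floor_iff t).mpr ht
  have hpsi := psi_le hfloor
  have hle : (⌊t⌋₊ : ℝ) ≤ t := Nat.floor_le (by linarith)
  have hfloor' : (1 : ℝ) ≤ (⌊t⌋₊ : ℝ) := by exact_mod_cast hfloor
  have hlog0 : 0 ≤ Real.log (⌊t⌋₊ : ℝ) := Real.log_nonneg hfloor'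
  have hlog : Real.log (⌊t⌋₊ : ℝ) ≤ Real.log t := Real.log_le_log (by linarith) hle
  have hA := chebyshevConst_mem
  have hlin : 1.2 * chebyshevConst * ⌊t⌋₊ ≤ 1.10556 * t := by
    have : 1.2 * chebyshevConst ≤ 1.10556 := by linarith [hA.2]
    gcongr
  have hsq : (Real.log (⌊t⌋₊ : ℝ) + 1) ^ 2 ≤ (Real.log t + 1) ^ 2 := by gcongr
  have htheta := Chebyshev.theta_le_psi t
  rw [Chebyshev.psi_eq_psi_coe_floor] at htheta
  linarith

theorem log_1020_gt : 6.9 < Real.log 1020 := by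
  have hmono : Real.log 1000 ≤ Real.log 1020 := Real.log_le_log (by norm_num) (by norm_num)
  have heq : Real.log 1000 = 3 * (Real.log 2 + Real.log 5) := by
    rw [← Real.log_mul (by norm_num) (by norm_num), show (1000 : ℝ) = (2 * 5) ^ 3 by norm_num,
      Real.log_pow]
    norm_num
  linarith [Real.log_two_gt_d9, Real.log_five_gt_d9]

theorem hasDerivAt_primeCountingMajorant {t : ℝ} (ht : 1 < t) :
    HasDerivAt (fun t => 1.10556 * (t * (1 / Real.log t ^ 2 + 3.6 / Real.log t ^ 3))
        + 3.3 * Real.log t)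
      (1.10556 * (1 / Real.log t ^ 2 + 1.6 / Real.log t ^ 3 - 10.8 / Real.log t ^ 4) + 3.3 / t)
      t := by
  have hlog : HasDerivAt Real.log t⁻¹ t := Real.hasDerivAt_log (by linarith)
  have hlog0 : Real.log t ≠ 0 := (Real.log_pos ht).ne'
  have ht0 : t ≠ 0 := by linarith
  have h2 := (hasDerivAt_const t (1 : ℝ)).div (hlog.pow 2) (pow_ne_zero 2 hlog0)
  have h3 := (hasDerivAt_const t (3.6 : ℝ)).div (hlog.pow 3) (pow_ne_zero 3 hlog0)
  refine ((((hasDerivAt_id t).mul (h2.add h3)).const_mul 1.10556).add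
    (hlog.const_mul 3.3)).congr_deriv ?_
  simp only [Pi.add_apply, Pi.div_apply, Pi.pow_apply, id]
  field_simp
  ring

theorem theta_div_le {t : ℝ} (ht : 1020 ≤ t) :
    Chebyshev.theta t / (t * Real.log t ^ 2) ≤
      1.10556 * (1 / Real.log t ^ 2 + 1.6 / Real.log t ^ 3 - 10.8 / Real.log t ^ 4)
        + 3.3 / t := by
  have hL : 6.9 < Real.log t := log_1020_gt.trans_le (Real.log_le_log (by norm_num) ht)
  have htheta := theta_le (by linarith : 1 ≤ t)
  generalize Real.log t = L at *
  have hL0 : 0 < L := by linarith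
  have ht0 : 0 < t := by linarith
  have hsmall : 2 * (L + 1) ^ 2 + 30 ≤ 3.3 * L ^ 2 := by nlinarith
  have hgain : 0 ≤ 1.6 / L ^ 3 - 10.8 / L ^ 4 := by
    have : 1.6 / L ^ 3 - 10.8 / L ^ 4 = (1.6 * L - 10.8) / L ^ 4 := by field_simp
    rw [this]
    exact div_nonneg (by linarith) (by positivity)
  calc Chebyshev.theta t / (t * L ^ 2) ≤ (1.10556 * t + 3.3 * L ^ 2) / (t * L ^ 2) := by
        gcongr
        linarith
    _ = 1.10556 * (1 / L ^ 2) + 3.3 / t := by field_simp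
    _ ≤ _ := by linarith

theorem integral_theta_div_le {z : ℝ} (hz : 1020 ≤ z) :
    ∫ t in (1020 : ℝ)..z, Chebyshev.theta t / (t * Real.log t ^ 2) ≤
      1.10556 * (z * (1 / Real.log z ^ 2 + 3.6 / Real.log z ^ 3)) + 3.3 * Real.log z := by
  have hmain := intervalIntegral.integral_le_sub_of_hasDeriv_right_of_le hz
    (fun t ht => (hasDerivAt_primeCountingMajorant
      (by linarith [ht.1] : 1 < t)).continuousAt.continuousWithinAt)
    (fun t ht => (hasDerivAt_primeCountingMajorant
      (by linarith [ht.1] : 1 < t)).hasDerivWithinAt)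
    ((Chebyshev.integrableOn_theta_div_id_mul_log_sq z).mono_set
      (Set.Icc_subset_Icc_left (by norm_num)))
    (fun t ht => theta_div_le ht.1.le)
  have hlog := log_1020_gt
  refine hmain.trans (sub_le_self _ ?_)
  positivity

theorem primeCounting_1020_le : (Nat.primeCounting 1020 : ℝ) ≤ 172 := by
  have hcount : Nat.count Nat.Prime 1020 = 171 :=
    count_prime_of_mem_primeCountTable (1020, 171) (by decide)
  have hpi : Nat.primeCounting 1020 ≤ 172 := by
    rw [Nat.primeCounting, Nat.primeCounting', Nat.count_succ, hcount]
    split_ifs <;> omega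
  exact_mod_cast hpi

theorem primeCounting_floor_le_add {z : ℝ} (hz : 1020 ≤ z) :
    (Nat.primeCounting ⌊z⌋₊ : ℝ) ≤
      (1.10556 * z + 2 * (Real.log z + 1) ^ 2 + 30) / Real.log z + 172 +
      (1.10556 * (z * (1 / Real.log z ^ 2 + 3.6 / Real.log z ^ 3)) + 3.3 * Real.log z) := by
  have hlog : 0 < Real.log z := Real.log_pos (by linarith)
  have hhead : ∫ t in (2 : ℝ)..1020, Chebyshev.theta t / (t * Real.log t ^ 2) ≤ 172 := by
    have heq := Chebyshev.primeCounting_eq_theta_div_log_add_integral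
      (by norm_num : (2 : ℝ) ≤ 1020)
    rw [show ⌊(1020 : ℝ)⌋₊ = 1020 from Nat.floor_ofNat 1020] at heq
    have hnonneg : 0 ≤ Chebyshev.theta 1020 / Real.log 1020 :=
      div_nonneg (Chebyshev.theta_nonneg _) (by linarith [log_1020_gt])
    linarith [primeCounting_1020_le]
  have hintegrable (a b : ℝ) (ha : 2 ≤ a) (hab : a ≤ b) : IntervalIntegrable
      (fun t => Chebyshev.theta t / (t * Real.log t ^ 2)) MeasureTheory.volume a b := by
    rw [intervalIntegrable_iff_integrableOn_Icc_of_le hab]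
    exact (Chebyshev.integrableOn_theta_div_id_mul_log_sq b).mono_set
      (Set.Icc_subset_Icc_left ha)
  rw [Chebyshev.primeCounting_eq_theta_div_log_add_integral (by linarith : 2 ≤ z),
    ← intervalIntegral.integral_add_adjacent_intervals (hintegrable 2 1020 le_rfl (by norm_num))
      (hintegrable 1020 z (by norm_num) hz)]
  have htheta : Chebyshev.theta z / Real.log z ≤
      (1.10556 * z + 2 * (Real.log z + 1) ^ 2 + 30) / Real.log z := by
    gcongr
    exact theta_le (by linarith)
  linarith [integral_theta_div_le hz]

theorem primeCounting_floor_le {z : ℝ} (hz0 : 0 < z) (hz : 12 ≤ Real.log z) :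
    (Nat.primeCounting ⌊z⌋₊ : ℝ) ≤ 1.244 * z / Real.log z := by
  have hexp : 162700 ≤ Real.exp 12 := by
    rw [show (12 : ℝ) = (12 : ℕ) * 1 by norm_num, Real.exp_nat_mul]
    calc (162700 : ℝ) ≤ 2.7182818283 ^ 12 := by norm_num
      _ ≤ _ := by
        gcongr
        exact Real.exp_one_gt_d9.le
  have hquad : 1129 * Real.log z ^ 2 ≤ z := by
    have hsplit : z = Real.exp 12 * Real.exp (Real.log z - 12) := by
      rw [← Real.exp_add, add_sub_cancel, Real.exp_log hz0]
    have htail := Real.quadratic_le_exp_of_nonneg (by linarith : 0 ≤ Real.log z - 12)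
    calc 1129 * Real.log z ^ 2
        ≤ 162700 * (1 + (Real.log z - 12) + (Real.log z - 12) ^ 2 / 2) := by nlinarith
      _ ≤ Real.exp 12 * Real.exp (Real.log z - 12) := by
        gcongr
      _ = z := hsplit.symm
  have hbound := primeCounting_floor_le_add (by nlinarith : 1020 ≤ z)
  generalize Real.log z = L at *
  have hL0 : 0 < L := by linarith
  refine hbound.trans ?_
  rw [le_div_iff₀ hL0]
  have hexpand : ((1.10556 * z + 2 * (L + 1) ^ 2 + 30) / L + 172 +
      (1.10556 * (z * (1 / L ^ 2 + 3.6 / L ^ 3)) + 3.3 * L)) * L =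
      1.10556 * z * (1 + 1 / L + 3.6 / L ^ 2) + (5.3 * L ^ 2 + 176 * L + 32) := by
    field_simp
    ring
  rw [hexpand]
  have hmain : 1 + 1 / L + 3.6 / L ^ 2 ≤ 1 + 1 / 12 + 3.6 / 12 ^ 2 := by gcongr
  have herror : 5.3 * L ^ 2 + 176 * L + 32 ≤ 20.2 * L ^ 2 := by nlinarith
  have hmain' : 1.10556 * z * (1 + 1 / L + 3.6 / L ^ 2) ≤
      1.10556 * z * (1 + 1 / 12 + 3.6 / 12 ^ 2) := by gcongr
  linarith

theorem primeCounting_ge {N : ℕ} (hN : 13 ≤ Real.log N) :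
    0.9211 * N / Real.log N ≤ (Nat.primeCounting N : ℝ) := by
  have hN0 : (0 : ℝ) < N := by
    rcases Nat.eq_zero_or_pos N with rfl | h
    · norm_num at hN
    · exact_mod_cast h
  have hexp : 442400 ≤ Real.exp 13 := by
    rw [show (13 : ℝ) = (13 : ℕ) * 1 by norm_num, Real.exp_nat_mul]
    calc (442400 : ℝ) ≤ 2.7182818283 ^ 13 := by norm_num
      _ ≤ _ := by
        gcongr
        exact Real.exp_one_gt_d9.le
  have hlin : 34000 * Real.log N ≤ N := by
    have hsplit : (N : ℝ) = Real.exp 13 * Real.exp (Real.log N - 13) := by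
      rw [← Real.exp_add, add_sub_cancel, Real.exp_log hN0]
    have htail := Real.add_one_le_exp (Real.log N - 13)
    calc 34000 * Real.log N ≤ 442400 * (Real.log N - 13 + 1) := by linarith
      _ ≤ Real.exp 13 * Real.exp (Real.log N - 13) := by
        gcongr
      _ = N := hsplit.symm
  have hN30 : 30 ≤ N := by
    have : (30 : ℝ) ≤ N := by linarith
    exact_mod_cast this
  have hpsi := psi_ge hN30
  have hpi := Chebyshev.psi_le_primeCounting_mul_log N
  have hA := chebyshevConst_mem
  rw [div_le_iff₀ (by linarith)]
  nlinarith [mul_le_mul_of_nonneg_right hA.1.le hN0.le]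

theorem quartic_ratio_bound {t : ℝ} (ht : 1 / 3 ≤ t) (ht1 : t ≤ 1) :
    1.244 ^ 2 * (1 + t ^ 2 / 0.9154 ^ 2) * (1 + t / 13) ^ 2 ≤
      5 / 4 * (0.9211 * (1 + t)) ^ 2 := by
  have hchord : 0 ≤ (t - 1 / 3) * (1 - t) := mul_nonneg (by linarith) (by linarith)
  have hchord' : 0 ≤ t * ((t - 1 / 3) * (1 - t)) := mul_nonneg (by linarith) hchord
  have hlin : (1 + t / 13) ^ 2 ≤ 0.9981 + 0.162 * t := by linarith
  have hquad : 1.244 ^ 2 * (1 + t ^ 2 / 0.9154 ^ 2) ≤ 1.5476 + 1.847 * t ^ 2 := by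
    have : t ^ 2 / 0.9154 ^ 2 ≤ 1.1934 * t ^ 2 := by
      rw [div_le_iff₀ (by norm_num)]
      linarith [sq_nonneg t]
    linarith [sq_nonneg t]
  calc 1.244 ^ 2 * (1 + t ^ 2 / 0.9154 ^ 2) * (1 + t / 13) ^ 2
      ≤ (1.5476 + 1.847 * t ^ 2) * (0.9981 + 0.162 * t) := by gcongr
    _ ≤ 5 / 4 * (0.9211 * (1 + t)) ^ 2 := by linarith

theorem sq_add_sq_le_of_ge {x y : ℕ} (hyx : y ≤ x) (hx : 500000 ≤ x) :
    (Nat.primeCounting x : ℝ) ^ 2 + (Nat.primeCounting y : ℝ) ^ 2 ≤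
      5 / 4 * (Nat.primeCounting (x + y) : ℝ) ^ 2 := by
  have hxR : (500000 : ℝ) ≤ x := by exact_mod_cast hx
  have hyxR : (y : ℝ) ≤ x := by exact_mod_cast hyx
  have hx0 : (0 : ℝ) < x := by linarith
  have hL : 13 ≤ Real.log x := by
    rw [Real.le_log_iff_exp_le hx0, show (13 : ℝ) = (13 : ℕ) * 1 by norm_num, Real.exp_nat_mul]
    calc Real.exp 1 ^ 13 ≤ 2.7182818286 ^ 13 := by
          gcongr
          exact Real.exp_one_lt_d9.le
      _ ≤ 500000 := by norm_num
      _ ≤ x := hxR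
  have hL0 : 0 < Real.log x := by linarith
  have hthird : 0.9154 * Real.log x ≤ Real.log (x / 3) := by
    rw [Real.log_div hx0.ne' (by norm_num)]
    linarith [Real.log_three_lt_d9]
  have hthird12 : 12 ≤ Real.log (x / 3) := by
    rw [Real.le_log_iff_exp_le (by positivity), show (12 : ℝ) = (12 : ℕ) * 1 by norm_num,
      Real.exp_nat_mul]
    calc Real.exp 1 ^ 12 ≤ 2.7182818286 ^ 12 := by
          gcongr
          exact Real.exp_one_lt_d9.le
      _ ≤ 500000 / 3 := by norm_num
      _ ≤ x / 3 := by gcongr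
  rcases lt_or_ge (y : ℝ) (x / 3) with hsmall | hlarge
  · have hpiy : (Nat.primeCounting y : ℝ) ≤ 1.244 * (x / 3) / (0.9154 * Real.log x) := by
      have hmono : Nat.primeCounting y ≤ Nat.primeCounting ⌊(x : ℝ) / 3⌋₊ :=
        Nat.monotone_primeCounting (Nat.le_floor hsmall.le)
      calc (Nat.primeCounting y : ℝ) ≤ Nat.primeCounting ⌊(x : ℝ) / 3⌋₊ := by exact_mod_cast hmono
        _ ≤ 1.244 * (x / 3) / Real.log (x / 3) :=
          primeCounting_floor_le (by positivity) hthird12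
        _ ≤ _ := by gcongr
    have hpix := primeCounting_ge hL
    have hhalf : 2 * (Nat.primeCounting y : ℝ) ≤ Nat.primeCounting x := by
      refine le_trans ?_ hpix
      calc 2 * (Nat.primeCounting y : ℝ) ≤ 2 * (1.244 * (x / 3) / (0.9154 * Real.log x)) := by
            gcongr
        _ = (2 * 1.244 / 3 / 0.9154) * x / Real.log x := by
            field_simp
        _ ≤ _ := by
            gcongr
            norm_num
    have hsum : (Nat.primeCounting x : ℝ) ≤ Nat.primeCounting (x + y) := by
      exact_mod_cast Nat.monotone_primeCounting (Nat.le_add_right x y)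
    have hy0 : (0 : ℝ) ≤ Nat.primeCounting y := Nat.cast_nonneg _
    nlinarith
  · obtain ⟨t, hyt⟩ : ∃ t : ℝ, (y : ℝ) = t * x := ⟨y / x, by field_simp⟩
    have ht : 1 / 3 ≤ t := by
      refine le_of_mul_le_mul_right ?_ hx0
      linarith
    have ht1 : t ≤ 1 := by
      refine le_of_mul_le_mul_right ?_ hx0
      linarith
    have hlogy : Real.log (x / 3) ≤ Real.log y := Real.log_le_log (by positivity) hlarge
    have hpix := primeCounting_floor_le hx0 (by linarith : 12 ≤ Real.log x)
    have hpiy := primeCounting_floor_le (by linarith : (0 : ℝ) < y) (hthird12.trans hlogy)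
    rw [Nat.floor_natCast] at hpix hpiy
    have hpiy' : (Nat.primeCounting y : ℝ) ≤ 1.244 * (t * x) / (0.9154 * Real.log x) := by
      refine hpiy.trans ?_
      rw [hyt]
      gcongr
      rw [← hyt]
      exact hthird.trans hlogy
    have hlogadd : Real.log ((x + y : ℕ) : ℝ) ≤ Real.log x * (1 + t / 13) := by
      have heq : ((x + y : ℕ) : ℝ) = x * (1 + t) := by
        push_cast
        rw [hyt]
        ring
      rw [heq, Real.log_mul hx0.ne' (by linarith)]
      have := Real.log_le_sub_one_of_pos (x := 1 + t) (by linarith)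
      nlinarith
    have hlogge : Real.log x ≤ Real.log ((x + y : ℕ) : ℝ) :=
      Real.log_le_log hx0 (by exact_mod_cast Nat.le_add_right x y)
    have hpisum : 0.9211 * (x * (1 + t)) / (Real.log x * (1 + t / 13)) ≤
        (Nat.primeCounting (x + y) : ℝ) := by
      refine le_trans ?_ (primeCounting_ge (hL.trans hlogge))
      have heq : ((x + y : ℕ) : ℝ) = x * (1 + t) := by
        push_cast
        rw [hyt]
        ring
      rw [heq] at hlogadd hlogge ⊢
      gcongr
      linarith
    have ht0 : 0 < 1 + t / 13 := by linarith
    calc (Nat.primeCounting x : ℝ) ^ 2 + (Nat.primeCounting y : ℝ) ^ 2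
        ≤ (1.244 * x / Real.log x) ^ 2 + (1.244 * (t * x) / (0.9154 * Real.log x)) ^ 2 := by
          gcongr
      _ = (x / Real.log x) ^ 2 * (1.244 ^ 2 * (1 + t ^ 2 / 0.9154 ^ 2) * (1 + t / 13) ^ 2)
          / (1 + t / 13) ^ 2 := by
          field_simp
      _ ≤ (x / Real.log x) ^ 2 * (5 / 4 * (0.9211 * (1 + t)) ^ 2) / (1 + t / 13) ^ 2 := by
          gcongr ?_ * ?_ / ?_
          exact quartic_ratio_bound ht ht1
      _ = 5 / 4 * (0.9211 * (x * (1 + t)) / (Real.log x * (1 + t / 13))) ^ 2 := by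
          field_simp
      _ ≤ 5 / 4 * (Nat.primeCounting (x + y) : ℝ) ^ 2 := by
          gcongr

/-- Alzer (2013): for all integers `x, y ≥ 2`,
`π(x)² + π(y)² ≤ (5/4) π(x+y)²`. -/
theorem alzer_primeCounting_sq (x y : ℕ) (hx : 2 ≤ x) (hy : 2 ≤ y) :
    (Nat.primeCounting x : ℝ) ^ 2 + (Nat.primeCounting y : ℝ) ^ 2 ≤
      (5 / 4) * (Nat.primeCounting (x + y) : ℝ) ^ 2 := by
  have hcomm : y + x = x + y := add_comm y x
  wlog hyx : y ≤ x generalizing x y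
  · have hswap := this y x hy hx hcomm.symm (le_of_not_ge hyx)
    rw [hcomm] at hswap
    linarith
  rcases lt_or_ge x 500000 with hlt | hge
  · have hfin : (4 : ℝ) * ((Nat.primeCounting x : ℝ) ^ 2 + (Nat.primeCounting y : ℝ) ^ 2) ≤
        5 * (Nat.primeCounting (x + y) : ℝ) ^ 2 := by
      exact_mod_cast sq_add_sq_le_of_lt hy hyx hlt
    linarith
  · exact sq_add_sq_le_of_ge hyx hge
end
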